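/- arXiv:1205.6830 — 3 statements merged into one kernel-verified Lean document; each statement's English description precedes it below -/
import Mathlib

section
/- Let A be a unital Banach algebra with identity of norm one, and let A_S be the real subspace of elements a such that ω(a) ∈ ℝ for all continuous linear functionals ω with ‖ω‖ = ω(1). If A = A_S + i A_S, then A_S ∩ i A_S = {0}, i.e., the decomposition of each element as a₁ + i a₂ with a₁, a₂ ∈ A_S is unique. -/
/-- An element `x` of a normed unital algebra with `‖1‖ = 1` is supported by a positive multiple
of a state of the form `c ↦ f (c * x)`. If all such functionals vanish on `a`, then `1 - z • a`
is bounded below by `1`. -/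
theorem norm_le_norm_one_sub_smul_mul {A : Type*} [NormedRing A] [NormedAlgebra ℂ A]
    (hone : ‖(1 : A)‖ = 1) {a : A}
    (ha : ∀ ω : A →L[ℂ] ℂ, (‖ω‖ : ℂ) = ω 1 → ω a = 0) (z : ℂ) (x : A) :
    ‖x‖ ≤ ‖(1 - z • a) * x‖ := by
  rcases eq_or_ne x 0 with rfl | hx
  · simp
  obtain ⟨f, hf, hfx⟩ := exists_dual_vector ℂ x (norm_ne_zero_iff.2 hx)
  let ω : A →L[ℂ] ℂ := f.comp ((ContinuousLinearMap.mul ℂ A).flip x)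
  have hω (c : A) : ω c = f (c * x) := rfl
  have hω1 : ω 1 = (‖x‖ : ℂ) := by rw [hω, one_mul, hfx]; rfl
  have hnorm : ‖ω‖ = ‖x‖ := by
    apply le_antisymm
    · refine ω.opNorm_le_bound (norm_nonneg x) fun c => ?_
      calc ‖ω c‖ ≤ ‖f‖ * ‖c * x‖ := f.le_opNorm _
        _ ≤ ‖x‖ * ‖c‖ := by rw [hf, one_mul, mul_comm]; exact norm_mul_le c x
    · simpa [hω1, hone] using ω.le_opNorm 1
  have hωa : ω a = 0 := ha ω (by rw [hnorm, hω1])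
  calc ‖x‖ = ‖ω (1 - z • a)‖ := by simp [hω1, hωa]
    _ ≤ ‖f‖ * ‖(1 - z • a) * x‖ := f.le_opNorm _
    _ = ‖(1 - z • a) * x‖ := by rw [hf, one_mul]

/-- In a complex Banach algebra, an element `a` such that every `1 - z • a` is bounded below
by `1` must vanish: the resolvent is entire and bounded. -/
theorem eq_zero_of_norm_le_norm_one_sub_smul_mul {A : Type*} [NormedRing A] [NormedAlgebra ℂ A]
    [CompleteSpace A] (hone : ‖(1 : A)‖ = 1) {a : A}
    (h : ∀ (z : ℂ) (x : A), ‖x‖ ≤ ‖(1 - z • a) * x‖) : a = 0 := by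
  have : Nontrivial A := nontrivial_of_ne (1 : A) 0 fun h0 => by simp [h0] at hone
  have hinv (z : ℂ) (u : Aˣ) (hu : (u : A) = 1 - z • a) : ‖(↑u⁻¹ : A)‖ ≤ 1 := by
    simpa [← hu, hone] using h z (↑u⁻¹ : A)
  have hball (n : ℕ) : ∀ z : ℂ, ‖z‖ * ‖a‖ ≤ n / 2 → IsUnit (1 - z • a) := by
    induction n with
    | zero =>
      intro z hz
      have h0 : z • a = 0 := by
        rw [← norm_le_zero_iff, norm_smul]
        simpa using hz
      simp [h0]
    | succ n ih =>
      intro w hw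
      have hn : (0 : ℝ) < n + 1 := by positivity
      push_cast at hw
      obtain ⟨u, hu⟩ := ih (((n / (n + 1) : ℝ) : ℂ) * w) (by
        rw [norm_mul, Complex.norm_real, Real.norm_of_nonneg (by positivity), mul_assoc]
        calc (n / (n + 1) : ℝ) * (‖w‖ * ‖a‖) ≤ n / (n + 1) * ((n + 1) / 2) := by gcongr
          _ = n / 2 := by field_simp)
      have hdiff : (1 - w • a) - u = -(((1 / (n + 1) : ℝ) : ℂ) • w • a) := by
        have hs : w = ((n / (n + 1) : ℝ) : ℂ) * w + ((1 / (n + 1) : ℝ) : ℂ) * w := by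
          rw [← add_mul, ← Complex.ofReal_add, ← add_div, div_self hn.ne']
          simp
        rw [hu, smul_smul]
        nth_rewrite 1 [hs]
        rw [add_smul]
        abel
      have hlt : ‖(1 - w • a) - u‖ < ‖(↑u⁻¹ : A)‖⁻¹ := by
        have h1 : 1 ≤ ‖(↑u⁻¹ : A)‖⁻¹ :=
          (one_le_inv₀ (norm_pos_iff.2 u⁻¹.ne_zero)).2 (hinv _ u hu)
        refine lt_of_lt_of_le ?_ h1
        rw [hdiff, norm_neg, norm_smul, norm_smul, Complex.norm_real,
          Real.norm_of_nonneg (by positivity)]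
        calc (1 / (n + 1) : ℝ) * (‖w‖ * ‖a‖) ≤ 1 / (n + 1) * ((n + 1) / 2) := by gcongr
          _ = 1 / 2 := by field_simp
          _ < 1 := by norm_num
      exact (u.ofNearby _ hlt).isUnit
  have hunit (z : ℂ) : IsUnit (1 - z • a) := by
    obtain ⟨n, hn⟩ := exists_nat_ge (2 * (‖z‖ * ‖a‖))
    exact hball n z (by linarith)
  have hd : Differentiable ℂ fun z : ℂ => Ring.inverse (1 - z • a) := by
    intro z
    obtain ⟨u, hu⟩ := hunit z
    have h1 : DifferentiableAt ℂ Ring.inverse (1 - z • a) :=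
      hu ▸ differentiableAt_inverse u.isUnit
    exact h1.comp z (by fun_prop : DifferentiableAt ℂ (fun z : ℂ => 1 - z • a) z)
  have hb : Bornology.IsBounded (Set.range fun z : ℂ => Ring.inverse (1 - z • a)) := by
    refine isBounded_iff_forall_norm_le.2 ⟨1, ?_⟩
    rintro _ ⟨z, rfl⟩
    obtain ⟨u, hu⟩ := hunit z
    simpa [← hu] using hinv z u hu
  have hconst := hd.apply_eq_apply_of_bounded hb 1 0
  obtain ⟨u, hu⟩ := hunit 1
  simp only [← hu, zero_smul, sub_zero, Ring.inverse_unit, Ring.inverse_one] at hconst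
  have hu1 : u = 1 := inv_eq_one.1 (Units.ext hconst)
  rw [hu1, Units.val_one, one_smul] at hu
  exact sub_eq_self.1 hu.symm


/-- If `A = A_S + i A_S`, then `A_S ∩ i A_S = {0}`, so the decomposition
`x = a₁ + i a₂` with `a₁, a₂ ∈ A_S` is unique. -/
theorem stmt10 {A : Type*} [NormedRing A] [NormedAlgebra ℂ A] [CompleteSpace A]
    (hone : ‖(1 : A)‖ = 1)
    (S : Set A)
    (hS : S = {a : A | ∀ ω : A →L[ℂ] ℂ, (‖ω‖ : ℂ) = ω 1 → (ω a).im = 0})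
    (hdec : ∀ x : A, ∃ a₁ ∈ S, ∃ a₂ ∈ S, x = a₁ + Complex.I • a₂) :
    (∀ a ∈ S, ∀ b ∈ S, a = Complex.I • b → a = 0) ∧
    ∀ x : A, ∀ a₁ ∈ S, ∀ a₂ ∈ S, ∀ b₁ ∈ S, ∀ b₂ ∈ S,
      x = a₁ + Complex.I • a₂ → x = b₁ + Complex.I • b₂ →
      a₁ = b₁ ∧ a₂ = b₂ := by
  have hinter : ∀ a ∈ S, ∀ b ∈ S, a = Complex.I • b → a = 0 := by
    subst hS
    intro a ha b hb hab
    refine eq_zero_of_norm_le_norm_one_sub_smul_mul hone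
      (norm_le_norm_one_sub_smul_mul hone fun ω hω => Complex.ext ?_ (ha ω hω))
    simp [hab, hb ω hω]
  have hsub : ∀ a ∈ S, ∀ b ∈ S, a - b ∈ S := by
    subst hS
    intro a ha b hb ω hω
    simp [ha ω hω, hb ω hω]
  refine ⟨hinter, fun x a₁ ha₁ a₂ ha₂ b₁ hb₁ b₂ hb₂ hxa hxb => ?_⟩
  have heq : a₁ - b₁ = Complex.I • (b₂ - a₂) := by
    rw [smul_sub, sub_eq_sub_iff_add_eq_add, ← hxa, hxb, add_comm]
  have h1 := hinter _ (hsub _ ha₁ _ hb₁) _ (hsub _ hb₂ _ ha₂) heq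
  rw [h1] at heq
  have h2 := (smul_eq_zero.1 heq.symm).resolve_left Complex.I_ne_zero
  exact ⟨sub_eq_zero.1 h1, (sub_eq_zero.1 h2).symm⟩
end

section
/- (Vidav–Palmer theorem) Let A be a unital Banach algebra with identity of norm one, and let A_S be the real subspace of all a ∈ A such that ω(a) is real for every continuous linear functional ω with ‖ω‖ = ω(1). If A = A_S + i A_S, then the map (a₁ + i a₂) ↦ (a₁ − i a₂) (for a₁, a₂ ∈ A_S) is well defined and is an involution on A that, together with the given norm, makes A a C*-algebra. -/
namespace VidavPalmer

open Filter Topology Complex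
open NormedSpace (exp)

section Banach

variable {A : Type*} [NormedRing A] [NormedAlgebra ℂ A]

/-- A state of a unital Banach algebra: a functional of norm at most one which is `1` at `1`. -/
def IsState (ω : A →L[ℂ] ℂ) : Prop := ‖ω‖ ≤ 1 ∧ ω 1 = 1

lemma IsState.norm_apply_le {ω : A →L[ℂ] ℂ} (hω : IsState ω) (x : A) : ‖ω x‖ ≤ ‖x‖ :=
  (ω.le_opNorm x).trans (mul_le_of_le_one_left (norm_nonneg x) hω.1)

/-- An element `h` is Hermitian when all the `exp (i t h)`, `t` real, are contractions. -/
def IsHermitian (h : A) : Prop := ∀ t : ℝ, ‖exp ((t * I : ℂ) • h)‖ ≤ 1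

variable [CompleteSpace A]

lemma exp_add_of_commute {x y : A} (h : Commute x y) : exp (x + y) = exp x * exp y := by
  let +nondep : NormedAlgebra ℚ A := .restrictScalars ℚ ℂ A
  exact NormedSpace.exp_add_of_commute h

lemma exp_mul_exp_neg (a : A) : exp a * exp (-a) = 1 := by
  rw [← exp_add_of_commute (Commute.refl a).neg_right, add_neg_cancel, NormedSpace.exp_zero]

lemma exp_neg_mul_exp (a : A) : exp (-a) * exp a = 1 := by
  simpa using exp_mul_exp_neg (-a)

omit [CompleteSpace A] in
lemma exp_smul_one (z : ℂ) : exp (z • (1 : A)) = cexp z • (1 : A) := by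
  have h := NormedSpace.algebraMap_exp_comm (𝔸 := A) z
  rw [Algebra.algebraMap_eq_smul_one, Algebra.algebraMap_eq_smul_one] at h
  rw [← h, Complex.exp_eq_exp_ℂ]

lemma exp_smul_sub_smul_one (a : A) (z w : ℂ) :
    exp (z • (a - w • (1 : A))) = cexp (-(z * w)) • exp (z • a) := by
  have : z • (a - w • (1 : A)) = z • a + (-(z * w)) • (1 : A) := by module
  rw [this, exp_add_of_commute ((Commute.one_right _).smul_right _), exp_smul_one]
  simp

variable [NormOneClass A]

omit [CompleteSpace A] [NormOneClass A] in
lemma norm_le_norm_sub_smul_mul {a : A} (ha : ∀ ω : A →L[ℂ] ℂ, IsState ω → (ω a).re ≤ 0)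
    {t : ℝ} (ht : 0 ≤ t) (x : A) : ‖x‖ ≤ ‖x - (t : ℂ) • (a * x)‖ := by
  rcases eq_or_ne x 0 with rfl | hx
  · simp
  have hx' : ‖x‖ ≠ 0 := norm_ne_zero_iff.2 hx
  obtain ⟨f, hf, hfx⟩ := exists_dual_vector ℂ x hx'
  let ω : A →L[ℂ] ℂ := ((‖x‖⁻¹ : ℝ) : ℂ) • f.comp ((ContinuousLinearMap.mul ℂ A).flip x)
  have hω (y : A) : ω y = ((‖x‖⁻¹ : ℝ) : ℂ) * f (y * x) := rfl
  have hst : IsState ω := by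
    constructor
    · refine ContinuousLinearMap.opNorm_le_bound _ zero_le_one fun y => ?_
      rw [hω, norm_mul, one_mul, norm_real, Real.norm_of_nonneg (by positivity)]
      have h1 := f.le_opNorm (y * x)
      rw [hf, one_mul] at h1
      rw [inv_mul_le_iff₀ (by positivity), mul_comm]
      exact h1.trans (norm_mul_le _ _)
    · rw [hω, one_mul, hfx, ofReal_inv]
      exact inv_mul_cancel₀ (ofReal_ne_zero.2 hx')
  have h2 := ha ω hst
  rw [hω, re_ofReal_mul, inv_mul_le_iff₀ (by positivity), mul_zero] at h2
  have h3 : (f (x - (t : ℂ) • (a * x))).re = ‖x‖ - t * (f (a * x)).re := by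
    rw [map_sub, map_smul, hfx, smul_eq_mul, sub_re, re_ofReal_mul]
    simp
  have h4 := (re_le_norm _).trans (f.le_opNorm (x - (t : ℂ) • (a * x)))
  rw [h3, hf, one_mul] at h4
  nlinarith

lemma norm_exp_le_one_of_dissipative {a : A}
    (ha : ∀ ω : A →L[ℂ] ℂ, IsState ω → (ω a).re ≤ 0) : ‖exp a‖ ≤ 1 := by
  have key (ε : ℝ) (hε : 0 < ε) (hε1 : ε < 1) : (1 - ε) * ‖exp a‖ ≤ 1 := by
    have hd : HasDerivAt (fun u : ℂ => exp (u • a)) a 0 := by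
      simpa using hasDerivAt_exp_smul_const (𝕂 := ℂ) a 0
    have hlo := (hasDerivAt_iff_isLittleO.1 hd).def hε
    have ht : Tendsto (fun n : ℕ => -((n : ℂ) + 1)⁻¹) atTop (𝓝 0) := by
      have h := tendsto_one_div_add_atTop_nhds_zero_nat (𝕜 := ℂ)
      simpa using h.neg
    obtain ⟨n, hn⟩ := (ht.eventually hlo).exists
    set N : ℝ := (n : ℝ) + 1 with hN
    have hN1 : 1 ≤ N := by simp [hN]
    have hNc : (N : ℂ) = (n : ℂ) + 1 := by simp [hN]
    rw [← hNc] at hn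
    set e : A := exp ((-(N : ℂ)⁻¹) • a) with he
    have hn' : ‖e - (1 - ((N⁻¹ : ℝ) : ℂ) • a)‖ ≤ ε * N⁻¹ := by
      have hN' : ‖-(N : ℂ)⁻¹ - 0‖ = N⁻¹ := by
        rw [sub_zero, norm_neg, norm_inv, norm_real, Real.norm_of_nonneg (by linarith)]
      have he' : e - (1 - ((N⁻¹ : ℝ) : ℂ) • a) = e - exp ((0 : ℂ) • a) - (-(N : ℂ)⁻¹ - 0) • a := by
        rw [zero_smul, NormedSpace.exp_zero, ofReal_inv]
        module
      rwa [he', ← hN']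
    have step (x : A) : (1 - ε * N⁻¹) * ‖x‖ ≤ ‖e * x‖ := by
      have h1 := norm_le_norm_sub_smul_mul ha (inv_nonneg.2 (zero_le_one.trans hN1)) x
      have h2 : x - ((N⁻¹ : ℝ) : ℂ) • (a * x)
          = e * x - (e - (1 - ((N⁻¹ : ℝ) : ℂ) • a)) * x := by
        rw [sub_mul, sub_mul, one_mul, smul_mul_assoc]; abel
      have h3 := norm_mul_le (e - (1 - ((N⁻¹ : ℝ) : ℂ) • a)) x
      have h4 := norm_sub_le (e * x) ((e - (1 - ((N⁻¹ : ℝ) : ℂ) • a)) * x)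
      rw [← h2] at h4
      nlinarith [norm_nonneg x]
    have hpos : 0 ≤ 1 - ε * N⁻¹ := by
      have : N⁻¹ ≤ 1 := inv_le_one_of_one_le₀ hN1
      nlinarith
    have iter (k : ℕ) (x : A) : (1 - ε * N⁻¹) ^ k * ‖x‖ ≤ ‖e ^ k * x‖ := by
      induction k generalizing x with
      | zero => simp
      | succ k ih =>
        calc (1 - ε * N⁻¹) ^ (k + 1) * ‖x‖ = (1 - ε * N⁻¹) ^ k * ((1 - ε * N⁻¹) * ‖x‖) := by ring
          _ ≤ (1 - ε * N⁻¹) ^ k * ‖e * x‖ := by gcongr; exact step x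
          _ ≤ _ := by rw [pow_succ, mul_assoc]; exact ih _
    have hpow : e ^ (n + 1) * exp a = 1 := by
      let +nondep : NormedAlgebra ℚ A := .restrictScalars ℚ ℂ A
      rw [he, ← NormedSpace.exp_nsmul, ← Nat.cast_smul_eq_nsmul ℂ, smul_smul]
      have : ((n + 1 : ℕ) : ℂ) * (-(N : ℂ)⁻¹) = -1 := by
        have h0 : (n : ℂ) + 1 ≠ 0 := Nat.cast_add_one_ne_zero n
        rw [hNc]; push_cast; field_simp
      rw [this, neg_one_smul, exp_neg_mul_exp]
    have h5 := iter (n + 1) (exp a)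
    rw [hpow, norm_one] at h5
    have h6 := one_add_mul_le_pow (a := -(ε * N⁻¹)) (by linarith) (n + 1)
    have h7 : 1 + ((n + 1 : ℕ) : ℝ) * -(ε * N⁻¹) = 1 - ε := by
      have h0 : N ≠ 0 := by positivity
      push_cast; rw [← hN]; field_simp; ring
    rw [h7, ← sub_eq_add_neg] at h6
    exact (mul_le_mul_of_nonneg_right h6 (norm_nonneg _)).trans h5
  have hlim : Tendsto (fun ε : ℝ => (1 - ε) * ‖exp a‖) (𝓝[>] 0) (𝓝 ((1 - 0) * ‖exp a‖)) :=
    ((continuous_const.sub continuous_id).mul continuous_const).continuousAt.mono_left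
      nhdsWithin_le_nhds
  rw [sub_zero, one_mul] at hlim
  refine le_of_tendsto hlim ?_
  filter_upwards [Ioo_mem_nhdsGT zero_lt_one] with ε hε using key ε hε.1 hε.2

omit [NormOneClass A] in
lemma re_le_zero_of_norm_exp_le_one {a : A}
    (ha : ∀ t : ℝ, 0 ≤ t → ‖exp ((t : ℂ) • a)‖ ≤ 1) {ω : A →L[ℂ] ℂ} (hω : IsState ω) :
    (ω a).re ≤ 0 := by
  have hd : HasDerivAt (fun u : ℂ => exp (u • a)) a ((0 : ℝ) : ℂ) := by
    simpa using hasDerivAt_exp_smul_const (𝕂 := ℂ) a 0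
  have hd2 : HasDerivAt (fun u : ℂ => ω (exp (u • a))) (ω a) ((0 : ℝ) : ℂ) :=
    ω.hasFDerivAt.comp_hasDerivAt _ hd
  have hd3 : HasDerivAt (fun t : ℝ => (ω (exp ((t : ℂ) • a))).re) (ω a).re 0 :=
    hd2.real_of_complex
  have hs := hd3.tendsto_slope_zero_right
  refine le_of_tendsto hs ?_
  filter_upwards [self_mem_nhdsWithin] with t ht
  have ht' : (0 : ℝ) < t := ht
  have h1 : (ω (exp (((0 + t : ℝ) : ℂ) • a))).re ≤ 1 :=
    (re_le_norm _).trans ((hω.norm_apply_le _).trans (ha _ (by simpa using ht'.le)))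
  have h2 : (ω (exp (((0 : ℝ) : ℂ) • a))).re = 1 := by simp [NormedSpace.exp_zero, hω.2]
  rw [h2, smul_eq_mul]
  exact mul_nonpos_of_nonneg_of_nonpos (by positivity) (by linarith)

lemma isHermitian_iff {h : A} :
    IsHermitian h ↔ ∀ ω : A →L[ℂ] ℂ, IsState ω → (ω h).im = 0 := by
  constructor
  · intro hh ω hω
    have h1 : (ω (I • h)).re ≤ 0 := re_le_zero_of_norm_exp_le_one
      (fun t _ => by simpa [smul_smul] using hh t) hω
    have h2 : (ω ((-I) • h)).re ≤ 0 := re_le_zero_of_norm_exp_le_one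
      (fun t _ => by simpa [smul_smul] using hh (-t)) hω
    simp at h1 h2
    linarith
  · intro hh t
    refine norm_exp_le_one_of_dissipative fun ω hω => ?_
    simp [hh ω hω]

omit [CompleteSpace A] in
lemma IsState.norm_eq_apply_one {ω : A →L[ℂ] ℂ} (h : IsState ω) :
    (‖ω‖ : ℂ) = ω 1 := by
  have h1 := h.1
  have h2 := ω.le_opNorm 1
  rw [h.2, norm_one, norm_one, mul_one] at h2
  rw [h.2, le_antisymm h1 h2, ofReal_one]

lemma isHermitian_iff_forall_norm_eq {h : A} :
    IsHermitian h ↔ ∀ ω : A →L[ℂ] ℂ, (‖ω‖ : ℂ) = ω 1 → (ω h).im = 0 := by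
  rw [isHermitian_iff]
  refine ⟨fun hh ω hω => ?_, fun hh ω hω => hh ω hω.norm_eq_apply_one⟩
  rcases eq_or_ne ω 0 with rfl | h0
  · simp
  have hn : ‖ω‖ ≠ 0 := norm_ne_zero_iff.2 h0
  have := hh (((‖ω‖⁻¹ : ℝ) : ℂ) • ω) ⟨by
    rw [norm_smul, norm_real, norm_inv, norm_norm, inv_mul_cancel₀ hn], by
    rw [smul_apply, ← hω, smul_eq_mul, ← ofReal_mul, inv_mul_cancel₀ hn,
      ofReal_one]⟩
  rw [smul_apply, smul_eq_mul, im_ofReal_mul] at this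
  exact (mul_eq_zero.1 this).resolve_left (inv_ne_zero hn)

lemma IsHermitian.im_eq_zero_of_mem_spectrum {h : A} (hh : IsHermitian h) {z : ℂ}
    (hz : z ∈ spectrum ℂ h) : z.im = 0 := by
  have key (t : ℝ) : (t * I * z).re ≤ 0 := by
    have h0 : (t * I : ℂ) * z ∈ spectrum ℂ ((t * I : ℂ) • h) := by
      have := spectrum.subset_polynomial_aeval h (Polynomial.C (t * I : ℂ) * Polynomial.X)
      simpa [Algebra.smul_def] using this ⟨z, hz, by simp⟩
    have h1 := spectrum.norm_le_norm_of_mem (spectrum.exp_mem_exp _ h0)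
    rw [← Complex.exp_eq_exp_ℂ, norm_exp] at h1
    exact Real.exp_le_one_iff.1 (h1.trans (hh t))
  have h1 := key 1
  have h2 := key (-1)
  simp at h1 h2
  linarith

lemma re_le_zero_of_mem_spectrum {a : A}
    (ha : ∀ ω : A →L[ℂ] ℂ, IsState ω → (ω a).re ≤ 0) {z : ℂ} (hz : z ∈ spectrum ℂ a) :
    z.re ≤ 0 := by
  have h1 := spectrum.norm_le_norm_of_mem (spectrum.exp_mem_exp _ hz)
  rw [← Complex.exp_eq_exp_ℂ, norm_exp] at h1
  exact Real.exp_le_one_iff.1 (h1.trans (norm_exp_le_one_of_dissipative ha))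

omit [NormOneClass A] in
lemma exists_norm_pow_le {a : A} {r s : ℝ} (hr : spectralRadius ℂ a ≤ ENNReal.ofReal r)
    (hs : 0 < s) (hrs : r < s) : ∃ C, 0 ≤ C ∧ ∀ n : ℕ, ‖a ^ n‖ ≤ C * s ^ n := by
  have hlt : spectralRadius ℂ a < ENNReal.ofReal s :=
    hr.trans_lt ((ENNReal.ofReal_lt_ofReal_iff hs).2 hrs)
  have hev := (spectrum.pow_norm_pow_one_div_tendsto_nhds_spectralRadius a).eventually_lt_const hlt
  obtain ⟨N, hN⟩ := eventually_atTop.1 hev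
  refine ⟨1 + ∑ k ∈ Finset.range (N + 1), ‖a ^ k‖ / s ^ k, by positivity, fun n => ?_⟩
  have hsn : 0 < s ^ n := pow_pos hs n
  by_cases hn : n ≤ N
  · have : ‖a ^ n‖ / s ^ n ≤ ∑ k ∈ Finset.range (N + 1), ‖a ^ k‖ / s ^ k :=
      Finset.single_le_sum (f := fun k => ‖a ^ k‖ / s ^ k) (fun i _ => by positivity)
        (Finset.mem_range.2 (by omega))
    rw [← div_le_iff₀ hsn]
    linarith
  · have hn0 : n ≠ 0 := by omega
    have h1 := (ENNReal.ofReal_lt_ofReal_iff hs).1 (hN n (by omega))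
    have h2 : ‖a ^ n‖ ≤ s ^ n := by
      have h3 := pow_le_pow_left₀ (by positivity) h1.le n
      rwa [← Real.rpow_natCast (‖a ^ n‖ ^ (1 / n : ℝ)), ← Real.rpow_mul (norm_nonneg _),
        one_div_mul_cancel (by exact_mod_cast hn0), Real.rpow_one] at h3
    refine h2.trans (le_mul_of_one_le_left hsn.le ?_)
    have : 0 ≤ ∑ k ∈ Finset.range (N + 1), ‖a ^ k‖ / s ^ k := by positivity
    linarith

omit [NormOneClass A] in
lemma exists_norm_exp_smul_le {a : A} {r s : ℝ} (hr : spectralRadius ℂ a ≤ ENNReal.ofReal r)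
    (hs : 0 < s) (hrs : r < s) : ∃ C, 0 ≤ C ∧ ∀ z : ℂ, ‖exp (z • a)‖ ≤ C * Real.exp (s * ‖z‖) := by
  obtain ⟨C, hC, hb⟩ := exists_norm_pow_le hr hs hrs
  refine ⟨C, hC, fun z => ?_⟩
  have hsum := NormedSpace.exp_series_hasSum_exp' (𝕂 := ℂ) (z • a)
  rw [← hsum.tsum_eq]
  have hre : HasSum (fun n : ℕ => C * ((s * ‖z‖) ^ n / n.factorial)) (C * Real.exp (s * ‖z‖)) := by
    rw [Real.exp_eq_exp_ℝ]
    exact (NormedSpace.expSeries_div_hasSum_exp (s * ‖z‖)).mul_left C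
  refine tsum_of_norm_bounded hre fun n => ?_
  rw [norm_smul, smul_pow, norm_smul, norm_inv, norm_pow, norm_natCast, mul_pow]
  have := hb n
  calc ((n.factorial : ℝ))⁻¹ * (‖z‖ ^ n * ‖a ^ n‖)
      ≤ ((n.factorial : ℝ))⁻¹ * (‖z‖ ^ n * (C * s ^ n)) := by gcongr
    _ = _ := by ring

omit [NormOneClass A] in
lemma IsHermitian.norm_exp_smul_le {h : A} (hh : IsHermitian h) {r : ℝ} (hr0 : 0 ≤ r)
    (hr : spectralRadius ℂ h ≤ ENNReal.ofReal r) {z : ℂ} (hz : 0 ≤ z.re) :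
    ‖exp (z • h)‖ ≤ Real.exp (r * z.re) := by
  have key (s : ℝ) (hrs : r < s) : ‖exp (z • h)‖ ≤ Real.exp (s * z.re) := by
    have hs : 0 < s := hr0.trans_lt hrs
    obtain ⟨C, hC, hb⟩ := exists_norm_exp_smul_le hr hs hrs
    let f : ℂ → A := fun w => cexp (-(s * w)) • exp (w • h)
    have hf (w : ℂ) : ‖f w‖ = Real.exp (-(s * w.re)) * ‖exp (w • h)‖ := by
      simp [f, norm_smul, norm_exp]
    have hd : Differentiable ℂ f := by
      have h1 : Differentiable ℂ fun w : ℂ => cexp (-(s * w)) := by fun_prop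
      exact h1.smul fun w => (hasDerivAt_exp_smul_const (𝕂 := ℂ) h w).differentiableAt
    have := PhragmenLindelof.right_half_plane_of_bounded_on_real (f := f) (C := 1) (z := z)
      hd.diffContOnCl ⟨1, by norm_num, 2 * s, ?_⟩ ⟨C, ?_⟩ ?_ hz
    · rw [hf, Real.exp_neg, inv_mul_le_iff₀ (Real.exp_pos _), mul_one] at this
      exact this
    · refine Asymptotics.IsBigO.of_bound C (Eventually.of_forall fun w => ?_)
      rw [hf, Real.norm_of_nonneg (Real.exp_pos _).le, Real.rpow_one]
      have h1 : -(s * w.re) ≤ s * ‖w‖ := by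
        have := neg_le_of_abs_le (abs_re_le_norm w)
        nlinarith
      calc Real.exp (-(s * w.re)) * ‖exp (w • h)‖
          ≤ Real.exp (s * ‖w‖) * (C * Real.exp (s * ‖w‖)) := by gcongr; exact hb w
        _ = C * Real.exp (2 * s * ‖w‖) := by
          rw [mul_left_comm, ← Real.exp_add]; ring_nf
    · rw [eventually_map]
      filter_upwards [eventually_ge_atTop 0] with x hx
      rw [hf, ofReal_re, Real.exp_neg, inv_mul_le_iff₀ (Real.exp_pos _)]
      have := hb x
      rw [norm_real, Real.norm_of_nonneg hx] at this
      linarith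
    · intro x
      rw [hf]
      simpa using hh x
  have hlim : Tendsto (fun s : ℝ => Real.exp (s * z.re)) (𝓝[>] r) (𝓝 (Real.exp (r * z.re))) :=
    (Real.continuous_exp.comp (continuous_id.mul continuous_const)).continuousAt.mono_left
      nhdsWithin_le_nhds
  exact ge_of_tendsto hlim (by filter_upwards [self_mem_nhdsWithin] with s hs using key s hs)

omit [CompleteSpace A] [NormOneClass A] in
lemma IsHermitian.neg {h : A} (hh : IsHermitian h) : IsHermitian (-h) := fun t => by
  simpa using hh (-t)

omit [NormOneClass A] in
lemma IsHermitian.norm_le {h : A} (hh : IsHermitian h) {r : ℝ} (hr0 : 0 < r)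
    (hr : spectralRadius ℂ h ≤ ENNReal.ofReal r) : ‖h‖ ≤ Real.exp 1 * r := by
  have hr' : spectralRadius ℂ (-h) ≤ ENNReal.ofReal r := by
    simpa [spectralRadius, ← spectrum.neg_eq, iSup_neg] using hr
  have hbd (z : ℂ) : ‖exp (z • h)‖ ≤ Real.exp (r * ‖z‖) := by
    rcases le_total 0 z.re with hz | hz
    · refine (hh.norm_exp_smul_le hr0.le hr hz).trans (Real.exp_le_exp.2 ?_)
      gcongr
      exact re_le_norm z
    · have := hh.neg.norm_exp_smul_le hr0.le hr' (z := -z) (by simpa using hz)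
      rw [neg_smul_neg] at this
      refine this.trans (Real.exp_le_exp.2 ?_)
      gcongr
      simpa using re_le_norm (-z)
  have hd : Differentiable ℂ fun w : ℂ => exp (w • h) := fun w =>
    (hasDerivAt_exp_smul_const (𝕂 := ℂ) h w).differentiableAt
  have := Complex.norm_deriv_le_of_forall_mem_sphere_norm_le (f := fun w : ℂ => exp (w • h))
    (c := 0) (inv_pos.2 hr0) (C := Real.exp 1) hd.diffContOnCl (fun z hz => ?_)
  · rw [(hasDerivAt_exp_smul_const (𝕂 := ℂ) h 0).deriv] at this
    simpa [NormedSpace.exp_zero] using this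
  · refine (hbd z).trans_eq ?_
    rw [mem_sphere_zero_iff_norm] at hz
    rw [hz, mul_inv_cancel₀ hr0.ne']

end Banach

section Hermitian

variable {A : Type*} [NormedRing A] [NormedAlgebra ℂ A] [CompleteSpace A]

omit [CompleteSpace A] in
lemma spectralRadius_le_ofReal {a : A} {r : ℝ} (h : ∀ z ∈ spectrum ℂ a, ‖z‖ ≤ r) :
    spectralRadius ℂ a ≤ ENNReal.ofReal r :=
  iSup₂_le fun z hz => by
    rw [← enorm_eq_nnnorm, ← ofReal_norm]
    exact ENNReal.ofReal_le_ofReal (h z hz)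

lemma IsHermitian.eq_zero {h : A} (hh : IsHermitian h) (h0 : ∀ z ∈ spectrum ℂ h, z = 0) :
    h = 0 := by
  have key (r : ℝ) (hr : 0 < r) : ‖h‖ ≤ Real.exp 1 * r :=
    hh.norm_le hr (spectralRadius_le_ofReal fun z hz => by rw [h0 z hz, norm_zero]; exact hr.le)
  have hlim : Tendsto (fun r : ℝ => Real.exp 1 * r) (𝓝[>] 0) (𝓝 (Real.exp 1 * 0)) :=
    (continuous_const.mul continuous_id).continuousAt.mono_left nhdsWithin_le_nhds
  rw [mul_zero] at hlim
  exact norm_le_zero_iff.1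
    (ge_of_tendsto hlim (by filter_upwards [self_mem_nhdsWithin] with r hr using key r hr))

variable [NormOneClass A]

lemma IsHermitian.of_forall {h : A} (hh : ∀ ω : A →L[ℂ] ℂ, IsState ω → (ω h).im = 0) :
    IsHermitian h := isHermitian_iff.2 hh

lemma IsHermitian.im_apply {h : A} (hh : IsHermitian h) {ω : A →L[ℂ] ℂ} (hω : IsState ω) :
    (ω h).im = 0 := isHermitian_iff.1 hh ω hω

lemma IsHermitian.add {h k : A} (hh : IsHermitian h) (hk : IsHermitian k) :
    IsHermitian (h + k) := .of_forall fun ω hω => by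
  simp [hh.im_apply hω, hk.im_apply hω]

lemma IsHermitian.sub {h k : A} (hh : IsHermitian h) (hk : IsHermitian k) :
    IsHermitian (h - k) := sub_eq_add_neg h k ▸ hh.add hk.neg

lemma IsHermitian.smul {h : A} (hh : IsHermitian h) (t : ℝ) :
    IsHermitian ((t : ℂ) • h) := .of_forall fun ω hω => by
  simp [hh.im_apply hω]

lemma isHermitian_one : IsHermitian (1 : A) := .of_forall fun ω hω => by simp [hω.2]

lemma IsHermitian.re_apply_le {h : A} (hh : IsHermitian h) {m : ℝ}
    (hm : ∀ z ∈ spectrum ℂ h, z.re ≤ m) {ω : A →L[ℂ] ℂ} (hω : IsState ω) : (ω h).re ≤ m := by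
  have : Nontrivial A := NormOneClass.nontrivial
  have hk : IsHermitian (h + (‖h‖ : ℂ) • (1 : A)) := hh.add (isHermitian_one.smul _)
  have hspec : ∀ z ∈ spectrum ℂ (h + (‖h‖ : ℂ) • (1 : A)), ‖z‖ ≤ m + ‖h‖ := by
    intro z hz
    rw [add_comm, ← Algebra.algebraMap_eq_smul_one, ← spectrum.singleton_add_eq] at hz
    obtain ⟨_, rfl, w, hw, rfl⟩ := hz
    have him := hh.im_eq_zero_of_mem_spectrum hw
    have hn := spectrum.norm_le_norm_of_mem hw
    have hw' : w = (w.re : ℂ) := Complex.ext rfl (by simpa using him)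
    have h1 := hm w hw
    rw [hw', norm_real, Real.norm_eq_abs] at hn
    have h2 := abs_le.1 hn
    dsimp only
    rw [hw', ← ofReal_add, norm_real, Real.norm_of_nonneg] <;> linarith
  have hm0 : 0 ≤ m + ‖h‖ := by
    obtain ⟨z, hz⟩ := spectrum.nonempty (h + (‖h‖ : ℂ) • (1 : A))
    exact (norm_nonneg z).trans (hspec z hz)
  have := re_le_zero_of_norm_exp_le_one
    (a := (h + (‖h‖ : ℂ) • (1 : A)) - ((m + ‖h‖ : ℝ) : ℂ) • (1 : A)) (fun t ht => ?_) hω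
  · simp [hω.2] at this
    linarith
  · rw [exp_smul_sub_smul_one, norm_smul, ← ofReal_mul, ← ofReal_neg, norm_exp, ofReal_re,
      Real.exp_neg, inv_mul_le_iff₀ (Real.exp_pos _), mul_one, mul_comm]
    exact hk.norm_exp_smul_le hm0 (spectralRadius_le_ofReal hspec) (by simpa using ht)

lemma re_le_of_mem_spectrum {a : A} {m : ℝ}
    (ha : ∀ ω : A →L[ℂ] ℂ, IsState ω → (ω a).re ≤ m) {z : ℂ} (hz : z ∈ spectrum ℂ a) :
    z.re ≤ m := by
  have h1 : z - m ∈ spectrum ℂ (a - algebraMap ℂ A m) := by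
    rw [← spectrum.sub_singleton_eq]
    exact ⟨z, hz, _, rfl, rfl⟩
  have := re_le_zero_of_mem_spectrum (fun ω hω => ?_) h1
  · simpa using this
  · rw [map_sub, Algebra.algebraMap_eq_smul_one, map_smul, hω.2]
    simpa using ha ω hω

lemma IsHermitian.eq_zero_of_I_smul {h : A} (hh : IsHermitian h) (hI : IsHermitian (I • h)) :
    h = 0 := by
  have h0 (ω : A →L[ℂ] ℂ) (hω : IsState ω) : (ω h).re = 0 := by
    simpa using hI.im_apply hω
  refine hh.eq_zero fun z hz => Complex.ext (le_antisymm ?_ ?_) (hh.im_eq_zero_of_mem_spectrum hz)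
  · exact re_le_zero_of_mem_spectrum (fun ω hω => (h0 ω hω).le) hz
  · have hz' : -z ∈ spectrum ℂ (-h) := by rwa [← spectrum.neg_eq, Set.neg_mem_neg]
    have := re_le_zero_of_mem_spectrum (fun ω hω => by simp [h0 ω hω]) hz'
    simpa using this

omit [NormOneClass A] in
lemma IsHermitian.exp_conj {h k : A} (hh : IsHermitian h) (hk : IsHermitian k) (t : ℝ) :
    IsHermitian (exp ((t * I : ℂ) • h) * k * exp ((-(t * I) : ℂ) • h)) := fun s => by
  let +nondep : NormedAlgebra ℚ A := .restrictScalars ℚ ℂ A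
  let u : Aˣ := ⟨exp ((t * I : ℂ) • h), exp ((-(t * I) : ℂ) • h), by
    rw [neg_smul, exp_mul_exp_neg], by rw [neg_smul, exp_neg_mul_exp]⟩
  have h1 := NormedSpace.exp_units_conj u ((s * I : ℂ) • k)
  have h2 : (s * I : ℂ) • (exp ((t * I : ℂ) • h) * k * exp ((-(t * I) : ℂ) • h))
      = u * ((s * I : ℂ) • k) * ↑u⁻¹ := by
    simp [u]
  rw [h2, h1]
  have hu : ‖(u : A)‖ ≤ 1 := hh t
  have hu' : ‖((u⁻¹ : Aˣ) : A)‖ ≤ 1 := by simpa [u] using hh (-t)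
  calc _ ≤ ‖(u : A)‖ * ‖exp ((s * I : ℂ) • k)‖ * ‖((u⁻¹ : Aˣ) : A)‖ := norm_mul₃_le
    _ ≤ 1 * 1 * 1 := by gcongr; exact hk s
    _ = 1 := by norm_num

lemma IsHermitian.I_smul_commutator {h k : A} (hh : IsHermitian h) (hk : IsHermitian k) :
    IsHermitian (I • (h * k - k * h)) := .of_forall fun ω hω => by
  have h1 : HasDerivAt (fun u : ℂ => exp (u • (I • h))) (I • h) ((0 : ℝ) : ℂ) := by
    simpa using hasDerivAt_exp_smul_const (𝕂 := ℂ) (I • h) 0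
  have h2 : HasDerivAt (fun u : ℂ => exp (u • (-(I • h)))) (-(I • h)) ((0 : ℝ) : ℂ) := by
    simpa using hasDerivAt_exp_smul_const (𝕂 := ℂ) (-(I • h)) 0
  have h3 := (h1.mul_const k).mul h2
  have h4 := (ω.hasFDerivAt.comp_hasDerivAt _ h3).comp_ofReal
  have h5 := (imCLM.hasFDerivAt (x := _)).comp_hasDerivAt _ h4
  have h6 : (fun t : ℝ => imCLM (ω (exp ((t : ℂ) • (I • h)) * k * exp ((t : ℂ) • (-(I • h))))))
      = fun _ => 0 := by
    ext t
    have := (hh.exp_conj hk t).im_apply hω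
    simpa [smul_smul] using this
  have h7 := h5.unique ((hasDerivAt_const (0 : ℝ) (0 : ℝ)).congr_of_eventuallyEq
    (Eventually.of_forall fun t => congr_fun h6 t))
  rw [← h7]
  simp [NormedSpace.exp_zero, sub_eq_add_neg]

end Hermitian

section Square

lemma eq_zero_of_mem_spectrum_of_sq_eq {B : Type*} [NormedCommRing B] [NormedAlgebra ℂ B]
    [CompleteSpace B] [NormOneClass B] {h a b : B} (hh : IsHermitian h) (ha : IsHermitian a)
    (hb : IsHermitian b) (heq : h * h = a + I • b) {z : ℂ} (hz : z ∈ spectrum ℂ b) : z = 0 := by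
  obtain ⟨φ, rfl⟩ := WeakDual.CharacterSpace.mem_spectrum_iff_exists.1 hz
  have him {x : B} (hx : IsHermitian x) : (φ x).im = 0 :=
    hx.im_eq_zero_of_mem_spectrum (AlgHom.apply_mem_spectrum φ x)
  have h1 := congr_arg Complex.im (congr_arg φ heq)
  rw [map_mul, map_add, map_smul] at h1
  simp [him hh, him ha] at h1
  exact Complex.ext h1.symm (him hb)

variable {A : Type*} [NormedRing A] [NormedAlgebra ℂ A] [CompleteSpace A] [NormOneClass A]

lemma IsHermitian.eq_zero_of_mul_self_eq {h a b : A} (hh : IsHermitian h) (ha : IsHermitian a)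
    (hb : IsHermitian b) (heq : h * h = a + I • b) : b = 0 := by
  have hcomm : h * b = b * h ∧ h * a = a * h := by
    have e : h * (a + I • b) = (a + I • b) * h := by rw [← heq, mul_assoc]
    rw [mul_add, add_mul, mul_smul_comm, smul_mul_assoc] at e
    have e1 : h * a - a * h = -(I • (h * b - b * h)) := by
      rw [smul_sub, neg_sub, sub_eq_sub_iff_add_eq_add, add_comm (I • (b * h)), ← e]
    have e2 : IsHermitian (I • (I • (h * b - b * h))) := by
      have := (hh.I_smul_commutator ha).neg
      rwa [e1, smul_neg, neg_neg] at this
    have e3 := (hh.I_smul_commutator hb).eq_zero_of_I_smul e2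
    rw [e3, neg_zero] at e1
    exact ⟨sub_eq_zero.1 ((smul_eq_zero.1 e3).resolve_left I_ne_zero), sub_eq_zero.1 e1⟩
  have hab : a * b = b * a := by
    have e : a * (h * h) = (h * h) * a := by
      rw [← mul_assoc, ← hcomm.2, mul_assoc, ← hcomm.2, mul_assoc]
    rw [heq, mul_add, add_mul, add_right_inj, mul_smul_comm, smul_mul_assoc] at e
    exact smul_right_injective A I_ne_zero e
  let s : Set A := {h, a, b}
  have hs : s ⊆ s.centralizer := by
    rintro x (rfl | rfl | rfl) y (rfl | rfl | rfl) <;> simp [hcomm.1, hcomm.2, hab]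
  let S : Subalgebra ℂ A := Subalgebra.centralizer ℂ s.centralizer
  have hsS : s ⊆ S := Set.subset_centralizer_centralizer
  have hmul (x y : S) : x * y = y * x :=
    Subtype.ext (y.2 _ (Set.centralizer_subset hs x.2))
  let _ : NormedCommRing S := { (inferInstance : NormedRing S) with mul_comm := hmul }
  have : CompleteSpace S :=
    (Set.isClosed_centralizer s.centralizer).isComplete.completeSpace_coe
  have : NormOneClass S := ⟨norm_one (α := A)⟩
  have hherm (x : S) (hx : IsHermitian (x : A)) : IsHermitian x := fun t => by
    let +nondep : NormedAlgebra ℚ A := .restrictScalars ℚ ℂ A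
    let +nondep : NormedAlgebra ℚ S := .restrictScalars ℚ ℂ S
    have := NormedSpace.map_exp S.val continuous_subtype_val ((t * I : ℂ) • x)
    change ‖S.val (exp ((t * I : ℂ) • x))‖ ≤ 1
    rw [this]
    exact hx t
  refine hb.eq_zero fun z hz => ?_
  exact eq_zero_of_mem_spectrum_of_sq_eq (h := (⟨h, hsS (by simp [s])⟩ : S))
    (a := ⟨a, hsS (by simp [s])⟩) (b := ⟨b, hsS (by simp [s])⟩) (hherm _ hh) (hherm _ ha)
    (hherm _ hb) (Subtype.ext heq) (AlgHom.spectrum_apply_subset S.val _ hz)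

variable (hdec : ∀ x : A, ∃ a b : A, IsHermitian a ∧ IsHermitian b ∧ x = a + I • b)

include hdec in
lemma IsHermitian.mul_self {h : A} (hh : IsHermitian h) : IsHermitian (h * h) := by
  obtain ⟨a, b, ha, hb, heq⟩ := hdec (h * h)
  rw [heq, hh.eq_zero_of_mul_self_eq ha hb heq, smul_zero, add_zero]
  exact ha

include hdec in
lemma IsHermitian.mul_add_mul {h k : A} (hh : IsHermitian h) (hk : IsHermitian k) :
    IsHermitian (h * k + k * h) := by
  have := (((hh.add hk).mul_self hdec).sub (hh.mul_self hdec)).sub (hk.mul_self hdec)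
  convert this using 1
  noncomm_ring

lemma IsHermitian.add_I_smul_inj {a b c d : A} (ha : IsHermitian a) (hb : IsHermitian b)
    (hc : IsHermitian c) (hd : IsHermitian d) (h : a + I • b = c + I • d) : a = c ∧ b = d := by
  have h1 : a - c = I • (d - b) := by
    rw [smul_sub, sub_eq_sub_iff_add_eq_add, h, add_comm]
  have h2 := (hd.sub hb).eq_zero_of_I_smul (h1 ▸ ha.sub hc)
  rw [h2, smul_zero, sub_eq_zero] at h1
  exact ⟨h1, (sub_eq_zero.1 h2).symm⟩

/-- The involution `a + i b ↦ a - i b` on an algebra spanned by its Hermitian elements. -/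
noncomputable def conj (x : A) : A :=
  (hdec x).choose - I • (hdec x).choose_spec.choose

lemma conj_add_I_smul {a b : A} (ha : IsHermitian a) (hb : IsHermitian b) :
    conj hdec (a + I • b) = a - I • b := by
  have h := (hdec (a + I • b)).choose_spec.choose_spec
  obtain ⟨h1, h2⟩ := ha.add_I_smul_inj hb h.1 h.2.1 h.2.2
  exact congr_arg₂ (fun u v => u - I • v) h1.symm h2.symm

lemma conj_of_isHermitian {a : A} (ha : IsHermitian a) : conj hdec a = a := by
  have h0 : IsHermitian (0 : A) := by simpa using ha.sub ha
  simpa using conj_add_I_smul hdec ha h0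

lemma conj_add (x y : A) : conj hdec (x + y) = conj hdec x + conj hdec y := by
  obtain ⟨a, b, ha, hb, rfl⟩ := hdec x
  obtain ⟨c, d, hc, hd, rfl⟩ := hdec y
  have : a + I • b + (c + I • d) = (a + c) + I • (b + d) := by module
  rw [this, conj_add_I_smul hdec ha hb, conj_add_I_smul hdec hc hd,
    conj_add_I_smul hdec (ha.add hc) (hb.add hd)]
  module

lemma conj_smul (c : ℂ) (x : A) : conj hdec (c • x) = (starRingEnd ℂ) c • conj hdec x := by
  obtain ⟨a, b, ha, hb, rfl⟩ := hdec x
  have h1 : c • (a + I • b)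
      = ((c.re : ℂ) • a - (c.im : ℂ) • b) + I • ((c.im : ℂ) • a + (c.re : ℂ) • b) := by
    conv_lhs => rw [← re_add_im c]
    match_scalars
    · ring
    · linear_combination (c.im : ℂ) * I_sq
  have h2 : (starRingEnd ℂ) c = c.re - c.im * I := by
    apply Complex.ext <;> simp
  rw [h1, conj_add_I_smul hdec ha hb, h2,
    conj_add_I_smul hdec ((ha.smul _).sub (hb.smul _)) ((ha.smul _).add (hb.smul _))]
  match_scalars
  · ring
  · linear_combination (-c.im : ℂ) * I_sq

lemma conj_conj (x : A) : conj hdec (conj hdec x) = x := by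
  obtain ⟨a, b, ha, hb, rfl⟩ := hdec x
  have : a - I • b = a + I • (-b) := by module
  rw [conj_add_I_smul hdec ha hb, this, conj_add_I_smul hdec ha hb.neg]
  module

lemma conj_mul_of_isHermitian {a b : A} (ha : IsHermitian a) (hb : IsHermitian b) :
    conj hdec (a * b) = b * a := by
  have h : a * b = ((2⁻¹ : ℝ) : ℂ) • (a * b + b * a)
      + I • (((-2⁻¹ : ℝ) : ℂ) • (I • (a * b - b * a))) := by
    push_cast
    match_scalars
    · linear_combination (2⁻¹ : ℂ) * I_sq
    · linear_combination (-2⁻¹ : ℂ) * I_sq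
  rw [h, conj_add_I_smul hdec ((ha.mul_add_mul hdec hb).smul _)
    ((ha.I_smul_commutator hb).smul _)]
  push_cast
  match_scalars
  · linear_combination (2⁻¹ : ℂ) * I_sq
  · linear_combination (-2⁻¹ : ℂ) * I_sq

lemma conj_mul (x y : A) : conj hdec (x * y) = conj hdec y * conj hdec x := by
  obtain ⟨a, b, ha, hb, rfl⟩ := hdec x
  obtain ⟨c, d, hc, hd, rfl⟩ := hdec y
  have h : (a + I • b) * (c + I • d) = a * c + I • (a * d) + I • (b * c) + I • I • (b * d) := by
    simp only [add_mul, mul_add, smul_mul_assoc, mul_smul_comm, smul_add]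
    abel
  rw [h]
  simp only [conj_add, conj_smul, conj_mul_of_isHermitian hdec ha hc,
    conj_mul_of_isHermitian hdec ha hd, conj_mul_of_isHermitian hdec hb hc,
    conj_mul_of_isHermitian hdec hb hd, conj_of_isHermitian hdec ha, conj_of_isHermitian hdec hb,
    conj_of_isHermitian hdec hc, conj_of_isHermitian hdec hd, conj_I]
  simp only [add_mul, mul_add, smul_mul_assoc, mul_smul_comm, smul_add]
  abel

end Square

section CauchySchwarz

variable {A : Type*} [Ring A] [Algebra ℂ A] [StarRing A] [StarModule ℂ A]

lemma norm_apply_sq_le {ψ : A →ₗ[ℂ] ℂ} (hstar : ∀ x, ψ (star x) = (starRingEnd ℂ) (ψ x))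
    (hpos : ∀ x, 0 ≤ (ψ (star x * x)).re) (x y : A) :
    ‖ψ (star x * y)‖ ^ 2 ≤ (ψ (star x * x)).re * (ψ (star y * y)).re := by
  let c : PreInnerProductSpace.Core ℂ A :=
    { inner x y := ψ (star x * y)
      conj_inner_symm x y := by rw [← hstar, star_mul, star_star]
      re_inner_nonneg := hpos
      add_left x y z := by rw [star_add, add_mul, map_add]
      smul_left x y r := by rw [star_smul, smul_mul_assoc, map_smul]; rfl }
  have h := InnerProductSpace.Core.inner_mul_inner_self_le (𝕜 := ℂ) x y
  have h2 : ‖ψ (star y * x)‖ = ‖ψ (star x * y)‖ := by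
    rw [← norm_conj, ← hstar, star_mul, star_star]
  change ‖ψ (star x * y)‖ * ‖ψ (star y * x)‖ ≤ _ at h
  rw [h2, ← sq] at h
  exact h

lemma le_mul_of_sq_le_mul_succ {u : ℕ → ℝ} {k s K : ℝ} (hk : 0 ≤ k) (hs : 0 < s)
    (hu : ∀ n, u n ^ 2 ≤ k * u (n + 1)) (hK : ∀ n, u n ≤ K * s ^ 2 ^ n) : u 0 ≤ s * k := by
  by_contra! hlt
  rcases hk.eq_or_lt with rfl | hk
  · have := hu 0
    rw [zero_mul] at this
    nlinarith
  have hv : 1 < u 0 / k / s := by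
    rwa [one_lt_div hs, lt_div_iff₀ hk]
  have hind (n : ℕ) : (u 0 / k) ^ 2 ^ n ≤ u n / k := by
    induction n with
    | zero => simp
    | succ n ih =>
      calc (u 0 / k) ^ 2 ^ (n + 1) = ((u 0 / k) ^ 2 ^ n) ^ 2 := by rw [pow_succ 2 n, pow_mul]
        _ ≤ (u n / k) ^ 2 := by
          have : 0 < u 0 / k := div_pos (lt_of_le_of_lt (by positivity) hlt) hk
          gcongr
        _ = u n ^ 2 / k / k := by rw [div_pow, sq k, div_div]
        _ ≤ u (n + 1) / k := by
          gcongr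
          rw [div_le_iff₀ hk, mul_comm]
          exact hu n
  obtain ⟨n, hn⟩ := pow_unbounded_of_one_lt (K / k) hv
  have h1 : (u 0 / k / s) ^ 2 ^ n ≤ K / k := by
    rw [div_pow, div_le_iff₀ (by positivity)]
    calc _ ≤ u n / k := hind n
      _ ≤ K * s ^ 2 ^ n / k := by gcongr; exact hK n
      _ = _ := by ring
  exact (hn.trans_le (pow_le_pow_right₀ hv.le Nat.lt_two_pow_self.le)).not_ge h1

lemma re_apply_le_mul_of_pow_le {ψ : A →ₗ[ℂ] ℂ}
    (hstar : ∀ x, ψ (star x) = (starRingEnd ℂ) (ψ x))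
    (hpos : ∀ x, 0 ≤ (ψ (star x * x)).re) {c : A} (hc : IsSelfAdjoint c) {K s : ℝ} (hs : 0 < s)
    (hK : ∀ n : ℕ, ‖ψ (c ^ n)‖ ≤ K * s ^ n) : (ψ c).re ≤ s * (ψ 1).re := by
  have h1 : 0 ≤ (ψ 1).re := by simpa using hpos 1
  have hstep {a : A} (ha : IsSelfAdjoint a) : (ψ a).re ^ 2 ≤ (ψ 1).re * (ψ (a ^ 2)).re := by
    have h := norm_apply_sq_le hstar hpos 1 a
    rw [star_one, one_mul, one_mul, ha.star_eq, ← sq] at h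
    exact (sq_le_sq' (abs_le.1 (abs_re_le_norm _)).1 (abs_le.1 (abs_re_le_norm _)).2).trans h
  simpa using le_mul_of_sq_le_mul_succ (u := fun n => (ψ (c ^ 2 ^ n)).re) h1 hs
    (fun n => by rw [pow_succ 2 n, pow_mul]; exact hstep (hc.pow _))
    (fun n => (re_le_norm _).trans (hK _))

end CauchySchwarz

section HermitianStar

variable {A : Type*} [NormedRing A] [NormedAlgebra ℂ A] [CompleteSpace A] [NormOneClass A]
  [StarRing A] [StarModule ℂ A] (hsa : ∀ h : A, IsSelfAdjoint h → IsHermitian h)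

include hsa

lemma apply_star {ω : A →L[ℂ] ℂ} (hω : IsState ω) (x : A) :
    ω (star x) = (starRingEnd ℂ) (ω x) := by
  have h1 := (hsa _ (realPart x).2).im_apply hω
  have h2 := (hsa _ (imaginaryPart x).2).im_apply hω
  have hx := realPart_add_I_smul_imaginaryPart x
  have hx' : star x = (realPart x : A) - I • (imaginaryPart x : A) := by
    conv_lhs => rw [← hx]
    rw [star_add, star_smul, (realPart x).2.star_eq, (imaginaryPart x).2.star_eq]
    simp [sub_eq_add_neg]
  conv_rhs => rw [← hx]
  rw [hx']
  apply Complex.ext <;> simp [h1, h2]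

omit [StarModule ℂ A] in
lemma re_apply_mul_self_nonneg {h : A} (hh : IsSelfAdjoint h) {ω : A →L[ℂ] ℂ} (hω : IsState ω) :
    0 ≤ (ω (h * h)).re := by
  have : Nontrivial A := NormOneClass.nontrivial
  have h1 : IsHermitian (-(h * h)) := hsa _ (IsSelfAdjoint.neg (by simpa [sq] using hh.pow 2))
  have h2 : (ω (-(h * h))).re ≤ 0 := by
    refine h1.re_apply_le (fun z hz => ?_) hω
    rw [← spectrum.neg_eq, Set.mem_neg, ← sq, spectrum.map_pow] at hz
    obtain ⟨w, hw, hwz⟩ := hz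
    have hi := (hsa h hh).im_eq_zero_of_mem_spectrum hw
    have := congr_arg re hwz
    simp [sq, hi] at this
    nlinarith [mul_self_nonneg w.re]
  simpa using h2

lemma re_apply_mul_star_add_nonneg (y : A) {ω : A →L[ℂ] ℂ} (hω : IsState ω) :
    0 ≤ (ω (y * star y)).re + (ω (star y * y)).re := by
  have h1 := re_apply_mul_self_nonneg hsa (realPart y).2 hω
  have h2 := re_apply_mul_self_nonneg hsa (imaginaryPart y).2 hω
  have hx := realPart_add_I_smul_imaginaryPart y
  set a : A := (realPart y : A)
  set b : A := (imaginaryPart y : A)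
  have ha : star a = a := (realPart y).2.star_eq
  have hb : star b = b := (imaginaryPart y).2.star_eq
  have h3 : y * star y + star y * y = (2 : ℂ) • (a * a) + (2 : ℂ) • (b * b) := by
    rw [← hx, star_add, star_smul, ha, hb]
    simp only [add_mul, mul_add, smul_mul_assoc, mul_smul_comm, smul_add, star_def, conj_I]
    match_scalars <;> ring_nf <;> simp
  have h4 := congr_arg re (congr_arg ω h3)
  simp at h4
  linarith

lemma re_apply_star_mul_self_nonneg (x : A) {ω : A →L[ℂ] ℂ} (hω : IsState ω) :
    0 ≤ (ω (star x * x)).re := by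
  have : Nontrivial A := NormOneClass.nontrivial
  have hc : IsSelfAdjoint (star x * x) := .star_mul_self x
  suffices h : ∀ z ∈ spectrum ℂ (star x * x), 0 ≤ z.re by
    have := (hsa _ hc).neg.re_apply_le (m := 0) (fun z hz => ?_) hω
    · simpa using this
    · rw [← spectrum.neg_eq, Set.mem_neg] at hz
      simpa using h _ hz
  intro z hz
  by_contra! hneg
  set c := star x * x with hc_def
  set R : ℝ := ‖c‖ + 1 with hR
  have hR0 : 0 < R := by positivity
  obtain ⟨n, hn⟩ := exists_nat_gt (R / -z.re)
  have hn0 : 0 < (n : ℝ) := lt_of_le_of_lt (by have := neg_pos.2 hneg; positivity) hn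
  let q : A := (1 - ((R⁻¹ : ℝ) : ℂ) • c) ^ n
  have hq : IsSelfAdjoint q := by
    refine IsSelfAdjoint.pow (.sub (.one A) ?_) n
    rw [isSelfAdjoint_iff, star_smul, hc.star_eq]
    simp
  let P : Polynomial ℂ :=
    Polynomial.X * (1 - Polynomial.C (((R⁻¹ : ℝ) : ℂ)) * Polynomial.X) ^ (2 * n)
  have hy : star (x * q) * (x * q) = Polynomial.aeval c P := by
    have hcq : q * c = c * q := by
      refine (Commute.pow_left ?_ n).eq
      exact (Commute.one_left c).sub_left ((Commute.refl c).smul_left _)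
    calc star (x * q) * (x * q) = q * c * q := by
          rw [star_mul, hq.star_eq, hc_def]; noncomm_ring
      _ = c * (q * q) := by rw [hcq, mul_assoc]
      _ = _ := by simp [P, q, two_mul, pow_add, Algebra.smul_def]
  have hreal : ∀ w ∈ spectrum ℂ c, ((w.re : ℂ) = w) ∧ |w.re| ≤ R := fun w hw => by
    have h1 : (w.re : ℂ) = w :=
      Complex.ext rfl (by simpa using ((hsa _ hc).im_eq_zero_of_mem_spectrum hw).symm)
    have h2 := (abs_re_le_norm w).trans (spectrum.norm_le_norm_of_mem hw)
    exact ⟨h1, by linarith⟩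
  have hspec : spectrum ℂ (star (x * q) * (x * q)) = (fun w : ℂ =>
      w * (1 - ((R⁻¹ : ℝ) : ℂ) * w) ^ (2 * n)) '' spectrum ℂ c := by
    rw [hy, spectrum.map_polynomial_aeval]
    simp [P]
  have hval (w : ℂ) (hw : w ∈ spectrum ℂ c) : (w * (1 - ((R⁻¹ : ℝ) : ℂ) * w) ^ (2 * n)).re
      = w.re * (1 - w.re / R) ^ (2 * n) := by
    rw [← (hreal w hw).1]
    rw [← ofReal_mul, ← ofReal_one, ← ofReal_sub, ← ofReal_pow, ← ofReal_mul, ofReal_re, ofReal_re,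
      inv_mul_eq_div]
  have hub : ∀ w ∈ spectrum ℂ (star (x * q) * (x * q)), w.re ≤ R / n := by
    rw [hspec]
    rintro _ ⟨w, hw, rfl⟩
    dsimp only
    rw [hval w hw]
    obtain ⟨-, hw2⟩ := hreal w hw
    rcases le_total w.re 0 with h0 | h0
    · exact (mul_nonpos_of_nonpos_of_nonneg h0 (by rw [pow_mul]; positivity)).trans (by positivity)
    · set s := w.re / R with hs
      have hs0 : 0 ≤ s := by positivity
      have hs1 : s ≤ 1 := (div_le_one hR0).2 ((le_abs_self _).trans hw2)
      have hws : w.re = R * s := by rw [hs]; field_simp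
      have hb := one_add_mul_le_pow (a := s) (by linarith) (2 * n)
      have hprod : (1 - s) ^ (2 * n) * (1 + s) ^ (2 * n) ≤ 1 := by
        rw [← mul_pow]
        exact pow_le_one₀ (by nlinarith) (by nlinarith)
      have hp0 : 0 ≤ (1 - s) ^ (2 * n) := pow_nonneg (by linarith) _
      rw [hws, mul_assoc, div_eq_mul_inv]
      refine mul_le_mul_of_nonneg_left ?_ hR0.le
      rw [← one_div, le_div_iff₀ hn0]
      push_cast at hb
      nlinarith [mul_le_mul_of_nonneg_left hb hp0, mul_nonneg hp0 (mul_nonneg hs0 hn0.le)]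
  have hub' : ∀ w ∈ spectrum ℂ ((x * q) * star (x * q)), w.re ≤ R / n := fun w hw => by
    rcases eq_or_ne w 0 with rfl | hw0
    · simp only [zero_re]; positivity
    · refine hub w (Set.mem_of_mem_sdiff (t := {0}) ?_)
      rw [spectrum.nonzero_mul_comm]
      exact ⟨hw, hw0⟩
  have hneg' : ∀ ω : A →L[ℂ] ℂ, IsState ω →
      (ω (-(star (x * q) * (x * q)))).re ≤ R / n := fun ω hω => by
    have h1 := (hsa _ (.mul_star_self (x * q))).re_apply_le hub' hω
    have h2 := re_apply_mul_star_add_nonneg hsa (x * q) hω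
    simp only [map_neg, neg_re]
    linarith
  have hmem : -(z * (1 - ((R⁻¹ : ℝ) : ℂ) * z) ^ (2 * n))
      ∈ spectrum ℂ (-(star (x * q) * (x * q))) := by
    rw [← spectrum.neg_eq, Set.neg_mem_neg, hspec]
    exact ⟨z, hz, rfl⟩
  have h5 := re_le_of_mem_spectrum hneg' hmem
  rw [neg_re, hval z hz] at h5
  have h6 : 1 ≤ (1 - z.re / R) ^ (2 * n) := by
    refine one_le_pow₀ ?_
    have := div_neg_of_neg_of_pos hneg hR0
    linarith
  have h7 : -z.re ≤ R / n := by nlinarith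
  rw [div_lt_iff₀ (by linarith)] at hn
  rw [le_div_iff₀ hn0] at h7
  linarith

end HermitianStar

section StateNorm

variable {A : Type*} [NormedRing A] [NormedAlgebra ℂ A]

lemma exists_isState [NormOneClass A] : ∃ ω : A →L[ℂ] ℂ, IsState ω := by
  obtain ⟨ω, h1, h2⟩ := exists_dual_vector ℂ (1 : A) (by simp)
  exact ⟨ω, h1.le, by simpa using h2⟩

variable [StarRing A]

/-- The square root of the supremum of `ω (x⋆ x)` over all states `ω`. -/
noncomputable def stateNorm (x : A) : ℝ :=
  √(⨆ ω : {ω : A →L[ℂ] ℂ // IsState ω}, (ω.1 (star x * x)).re)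

lemma stateNorm_nonneg (x : A) : 0 ≤ stateNorm x := Real.sqrt_nonneg _

variable [NormOneClass A]

lemma stateNorm_le {x : A} {m : ℝ} (hm : 0 ≤ m)
    (h : ∀ ω : A →L[ℂ] ℂ, IsState ω → (ω (star x * x)).re ≤ m ^ 2) : stateNorm x ≤ m := by
  have : Nonempty {ω : A →L[ℂ] ℂ // IsState ω} :=
    have ⟨ω, hω⟩ := exists_isState (A := A)
    ⟨⟨ω, hω⟩⟩
  exact Real.sqrt_le_iff.2 ⟨hm, ciSup_le fun ω => h ω.1 ω.2⟩

lemma stateNorm_sq_le_norm (x : A) : stateNorm x ^ 2 ≤ ‖star x * x‖ := by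
  have h : stateNorm x ≤ √‖star x * x‖ :=
    stateNorm_le (Real.sqrt_nonneg _) fun ω hω => by
      rw [Real.sq_sqrt (norm_nonneg _)]
      exact (re_le_norm _).trans (hω.norm_apply_le _)
  exact (Real.le_sqrt (stateNorm_nonneg _) (norm_nonneg _)).1 h

variable [CompleteSpace A] [StarModule ℂ A] (hsa : ∀ h : A, IsSelfAdjoint h → IsHermitian h)

include hsa

lemma re_apply_le_stateNorm_sq {ω : A →L[ℂ] ℂ} (hω : IsState ω) (x : A) :
    (ω (star x * x)).re ≤ stateNorm x ^ 2 := by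
  have hle : (ω (star x * x)).re
      ≤ ⨆ ω : {ω : A →L[ℂ] ℂ // IsState ω}, (ω.1 (star x * x)).re := by
    refine le_ciSup (f := fun ω : {ω : A →L[ℂ] ℂ // IsState ω} => (ω.1 (star x * x)).re)
      ⟨‖star x * x‖, ?_⟩ ⟨ω, hω⟩
    rintro _ ⟨ω, rfl⟩
    exact (re_le_norm _).trans (ω.2.norm_apply_le _)
  rw [stateNorm, Real.sq_sqrt ((re_apply_star_mul_self_nonneg hsa x hω).trans hle)]
  exact hle

lemma norm_apply_star_mul_le {ω : A →L[ℂ] ℂ} (hω : IsState ω) (x y : A) :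
    ‖ω (star x * y)‖ ≤ stateNorm x * stateNorm y := by
  have h := norm_apply_sq_le (ψ := ω.toLinearMap) (apply_star hsa hω)
    (fun x => re_apply_star_mul_self_nonneg hsa x hω) x y
  refine le_of_sq_le_sq (h.trans ?_) (mul_nonneg (stateNorm_nonneg x) (stateNorm_nonneg y))
  rw [mul_pow]
  exact mul_le_mul (re_apply_le_stateNorm_sq hsa hω x) (re_apply_le_stateNorm_sq hsa hω y)
    (re_apply_star_mul_self_nonneg hsa y hω) (sq_nonneg _)

lemma norm_apply_le_stateNorm {ω : A →L[ℂ] ℂ} (hω : IsState ω) (x : A) :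
    ‖ω x‖ ≤ stateNorm x := by
  have h1 : stateNorm (1 : A) ≤ 1 := stateNorm_le zero_le_one fun ω hω => by simp [hω.2]
  have h := norm_apply_star_mul_le hsa hω 1 x
  rw [star_one, one_mul] at h
  exact h.trans (mul_le_of_le_one_left (stateNorm_nonneg x) h1)

lemma stateNorm_add_le (x y : A) : stateNorm (x + y) ≤ stateNorm x + stateNorm y := by
  refine stateNorm_le (add_nonneg (stateNorm_nonneg x) (stateNorm_nonneg y)) fun ω hω => ?_
  have h1 := (re_le_norm _).trans (norm_apply_star_mul_le hsa hω x y)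
  have h2 := (re_le_norm _).trans (norm_apply_star_mul_le hsa hω y x)
  have h3 := re_apply_le_stateNorm_sq hsa hω x
  have h4 := re_apply_le_stateNorm_sq hsa hω y
  simp only [star_add, add_mul, mul_add, map_add, add_re]
  linarith

lemma stateNorm_smul_le (c : ℂ) (x : A) : stateNorm (c • x) ≤ ‖c‖ * stateNorm x := by
  refine stateNorm_le (mul_nonneg (norm_nonneg c) (stateNorm_nonneg x)) fun ω hω => ?_
  have h : star (c • x) * (c • x) = ((‖c‖ ^ 2 : ℝ) : ℂ) • (star x * x) := by
    rw [star_smul, smul_mul_smul_comm, ← normSq_eq_norm_sq, normSq_eq_conj_mul_self]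
    rfl
  rw [h, map_smul, smul_eq_mul, re_ofReal_mul, mul_pow]
  exact mul_le_mul_of_nonneg_left (re_apply_le_stateNorm_sq hsa hω x) (sq_nonneg _)

lemma stateNorm_sq_le (x : A) : stateNorm x ^ 2 ≤ stateNorm (star x * x) := by
  have h : stateNorm x ≤ √(stateNorm (star x * x)) :=
    stateNorm_le (Real.sqrt_nonneg _) fun ω hω => by
      rw [Real.sq_sqrt (stateNorm_nonneg _)]
      exact (re_le_norm _).trans (norm_apply_le_stateNorm hsa hω _)
  exact (Real.le_sqrt (stateNorm_nonneg _) (stateNorm_nonneg _)).1 h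

lemma spectralRadius_star_mul_self_le (x : A) :
    spectralRadius ℂ (star x * x) ≤ ENNReal.ofReal (stateNorm x ^ 2) := by
  refine spectralRadius_le_ofReal fun z hz => ?_
  have h1 := (hsa _ (.star_mul_self x)).im_eq_zero_of_mem_spectrum hz
  have h2 := re_le_of_mem_spectrum (fun ω hω => re_apply_le_stateNorm_sq hsa hω x) hz
  have h3 : -z.re ≤ 0 := re_le_of_mem_spectrum (a := -(star x * x)) (z := -z)
    (fun ω hω => by simpa using re_apply_star_mul_self_nonneg hsa x hω)
    (by rwa [← spectrum.neg_eq, Set.neg_mem_neg])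
  rw [show z = (z.re : ℂ) from Complex.ext rfl h1, norm_real, Real.norm_of_nonneg (by linarith)]
  exact h2

lemma stateNorm_mul_le (x y : A) : stateNorm (x * y) ≤ stateNorm x * stateNorm y := by
  refine stateNorm_le (mul_nonneg (stateNorm_nonneg x) (stateNorm_nonneg y)) fun ω hω => ?_
  have hc : IsSelfAdjoint (star x * x) := .star_mul_self x
  have key (s : ℝ) (hs : stateNorm x ^ 2 < s) :
      (ω (star (x * y) * (x * y))).re ≤ s * stateNorm y ^ 2 := by
    have hs0 : 0 < s := (sq_nonneg _).trans_lt hs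
    obtain ⟨C, hC, hb⟩ := exists_norm_pow_le (spectralRadius_star_mul_self_le hsa x) hs0 hs
    let ψ : A →ₗ[ℂ] ℂ :=
      ω.toLinearMap ∘ₗ (LinearMap.mulRight ℂ y) ∘ₗ (LinearMap.mulLeft ℂ (star y))
    have hψ (a : A) : ψ a = ω (star y * a * y) := rfl
    have h := re_apply_le_mul_of_pow_le (ψ := ψ) (c := star x * x) (K := ‖star y‖ * C * ‖y‖)
      (fun a => by
        rw [hψ, hψ, ← apply_star hsa hω]
        simp [mul_assoc])
      (fun a => by
        have := re_apply_star_mul_self_nonneg hsa (a * y) hω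
        simpa [hψ, mul_assoc] using this) hc hs0 (fun n => by
        calc ‖ψ ((star x * x) ^ n)‖ ≤ ‖star y * (star x * x) ^ n * y‖ := hω.norm_apply_le _
          _ ≤ ‖star y‖ * ‖(star x * x) ^ n‖ * ‖y‖ := norm_mul₃_le
          _ ≤ ‖star y‖ * (C * s ^ n) * ‖y‖ := by gcongr; exact hb n
          _ = _ := by ring)
    have h2 : star (x * y) * (x * y) = star y * (star x * x) * y := by
      simp [mul_assoc]
    rw [h2, ← hψ]
    refine h.trans (mul_le_mul_of_nonneg_left ?_ hs0.le)
    rw [hψ, mul_one]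
    exact re_apply_le_stateNorm_sq hsa hω y
  rw [mul_pow]
  have hlim : Tendsto (fun s : ℝ => s * stateNorm y ^ 2) (𝓝[>] (stateNorm x ^ 2))
      (𝓝 (stateNorm x ^ 2 * stateNorm y ^ 2)) :=
    (continuous_id.mul continuous_const).continuousAt.mono_left nhdsWithin_le_nhds
  exact ge_of_tendsto hlim (by filter_upwards [self_mem_nhdsWithin] with s hs using key s hs)

lemma stateNorm_le_stateNorm_star (x : A) : stateNorm x ≤ stateNorm (star x) := by
  have h := (stateNorm_sq_le hsa x).trans (stateNorm_mul_le hsa (star x) x)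
  rcases (stateNorm_nonneg x).eq_or_lt with h0 | h0
  · rw [← h0]
    exact stateNorm_nonneg _
  · rw [sq] at h
    exact le_of_mul_le_mul_right h h0

omit [StarModule ℂ A] in
lemma norm_le_exp_one_mul {a : A} (ha : IsSelfAdjoint a) {m : ℝ} (hm0 : 0 ≤ m)
    (hm : ∀ ω : A →L[ℂ] ℂ, IsState ω → |(ω a).re| ≤ m) : ‖a‖ ≤ Real.exp 1 * m := by
  have key (s : ℝ) (hs : m < s) : ‖a‖ ≤ Real.exp 1 * s := by
    refine (hsa a ha).norm_le (hm0.trans_lt hs) (spectralRadius_le_ofReal fun z hz => ?_)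
    have h1 := (hsa a ha).im_eq_zero_of_mem_spectrum hz
    have h2 := re_le_of_mem_spectrum (fun ω hω => (abs_le.1 (hm ω hω)).2) hz
    have h3 : -z.re ≤ m := re_le_of_mem_spectrum (a := -a) (z := -z)
      (fun ω hω => by
        rw [map_neg, neg_re]
        linarith [(abs_le.1 (hm ω hω)).1])
      (by rwa [← spectrum.neg_eq, Set.neg_mem_neg])
    rw [show z = (z.re : ℂ) from Complex.ext rfl h1, norm_real, Real.norm_eq_abs]
    exact (abs_le.2 ⟨by linarith, h2⟩).trans hs.le
  have hlim : Tendsto (fun s : ℝ => Real.exp 1 * s) (𝓝[>] m) (𝓝 (Real.exp 1 * m)) :=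
    (continuous_const.mul continuous_id).continuousAt.mono_left nhdsWithin_le_nhds
  exact ge_of_tendsto hlim (by filter_upwards [self_mem_nhdsWithin] with s hs using key s hs)

lemma norm_le_mul_stateNorm (x : A) : ‖x‖ ≤ 2 * Real.exp 1 * stateNorm x := by
  have hx := realPart_add_I_smul_imaginaryPart x
  have him {ω : A →L[ℂ] ℂ} (hω : IsState ω) {a : A} (ha : IsSelfAdjoint a) : (ω a).im = 0 :=
    (hsa a ha).im_apply hω
  have h1 : ‖(realPart x : A)‖ ≤ Real.exp 1 * stateNorm x :=
    norm_le_exp_one_mul hsa (realPart x).2 (stateNorm_nonneg x) fun ω hω => by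
      have h : (ω (realPart x : A)).re = (ω x).re := by
        conv_rhs => rw [← hx]
        simp [him hω (imaginaryPart x).2]
      rw [h]
      exact (abs_re_le_norm _).trans (norm_apply_le_stateNorm hsa hω x)
  have h2 : ‖(imaginaryPart x : A)‖ ≤ Real.exp 1 * stateNorm x :=
    norm_le_exp_one_mul hsa (imaginaryPart x).2 (stateNorm_nonneg x) fun ω hω => by
      have h : (ω (imaginaryPart x : A)).re = (ω x).im := by
        conv_rhs => rw [← hx]
        simp [him hω (realPart x).2]
      rw [h]
      exact (abs_im_le_norm _).trans (norm_apply_le_stateNorm hsa hω x)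
  calc ‖x‖ = ‖(realPart x : A) + I • (imaginaryPart x : A)‖ := by rw [hx]
    _ ≤ ‖(realPart x : A)‖ + ‖I • (imaginaryPart x : A)‖ := norm_add_le _ _
    _ ≤ _ := by rw [norm_smul, norm_I, one_mul]; linarith

lemma stateNorm_le_mul_norm (x : A) : stateNorm x ≤ 2 * Real.exp 1 * ‖x‖ := by
  rcases (stateNorm_nonneg x).eq_or_lt with h0 | h0
  · rw [← h0]
    positivity
  have h1 : stateNorm (star x) ≤ stateNorm x := by
    simpa using stateNorm_le_stateNorm_star hsa (star x)
  refine le_of_mul_le_mul_right ?_ h0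
  calc stateNorm x * stateNorm x = stateNorm x ^ 2 := (sq _).symm
    _ ≤ ‖star x‖ * ‖x‖ := (stateNorm_sq_le_norm x).trans (norm_mul_le _ _)
    _ ≤ (2 * Real.exp 1 * stateNorm x) * ‖x‖ := by
      gcongr
      exact (norm_le_mul_stateNorm hsa _).trans (by gcongr)
    _ = _ := by ring

end StateNorm

section Renormed

variable {A : Type*} [NormedRing A] [NormedAlgebra ℂ A] [CompleteSpace A] [NormOneClass A]
  [StarRing A] [StarModule ℂ A]

/-- The algebra `A` normed by `stateNorm`. -/
def Renormed (_ : ∀ h : A, IsSelfAdjoint h → IsHermitian h) : Type _ := A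

variable (hsa : ∀ h : A, IsSelfAdjoint h → IsHermitian h)

namespace Renormed

instance : Ring (Renormed hsa) := inferInstanceAs (Ring A)

instance : Algebra ℂ (Renormed hsa) := inferInstanceAs (Algebra ℂ A)

instance : StarRing (Renormed hsa) := inferInstanceAs (StarRing A)

instance : StarModule ℂ (Renormed hsa) := inferInstanceAs (StarModule ℂ A)

/-- The identity map from the renormed algebra to the original one. -/
def toOrig : Renormed hsa ≃⋆ₐ[ℂ] A := StarAlgEquiv.refl ℂ A

noncomputable instance : NormedAddCommGroup (Renormed hsa) :=
  AddGroupNorm.toNormedAddCommGroup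
    { toFun x := stateNorm (toOrig hsa x)
      map_zero' := by simp [stateNorm]
      add_le' x y := by rw [map_add]; exact stateNorm_add_le hsa _ _
      neg' x := by simp [stateNorm]
      eq_zero_of_map_eq_zero' x hx := by
        have := norm_le_mul_stateNorm hsa (toOrig hsa x)
        rw [hx, mul_zero, norm_le_zero_iff] at this
        simpa using this }

lemma norm_def (x : Renormed hsa) : ‖x‖ = stateNorm (toOrig hsa x) := rfl

noncomputable instance : NormedRing (Renormed hsa) where
  dist_eq := dist_eq_norm_neg_add
  norm_mul_le x y := by simpa [norm_def] using stateNorm_mul_le hsa _ _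

noncomputable instance : NormedAlgebra ℂ (Renormed hsa) where
  norm_smul_le c x := by simpa [norm_def] using stateNorm_smul_le hsa _ _

/-- The identity map as a linear homeomorphism. -/
noncomputable def homeo : Renormed hsa ≃L[ℂ] A :=
  (toOrig hsa).toAlgEquiv.toLinearEquiv.toContinuousLinearEquivOfBounds (2 * Real.exp 1)
    (2 * Real.exp 1) (fun _ => norm_le_mul_stateNorm hsa _) (stateNorm_le_mul_norm hsa)

instance : CompleteSpace (Renormed hsa) :=
  (completeSpace_congr (e := (homeo hsa).toLinearEquiv.toEquiv) (homeo hsa).isUniformEmbedding).2 inferInstance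

noncomputable instance : CStarAlgebra (Renormed hsa) where
  norm_mul_self_le x := by
    simpa [norm_def, sq, map_star] using stateNorm_sq_le hsa (toOrig hsa x)

end Renormed

end Renormed

section RussoDye

variable {B : Type*} [CStarAlgebra B]

/-- The submonoid generated by the exponentials `exp (i h)` with `h` self-adjoint. -/
noncomputable def expSubmonoid (B : Type*) [CStarAlgebra B] : Submonoid B :=
  Submonoid.closure (Set.range fun h : selfAdjoint B => exp (I • (h : B)))

lemma expSubmonoid_le_unitary : expSubmonoid B ≤ unitary B :=
  (Submonoid.closure_le).2 (by
    rintro _ ⟨h, rfl⟩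
    exact (selfAdjoint.expUnitary h).2)

lemma mem_expSubmonoid {u : B} (hu : u ∈ unitary B) (h : ‖u - 1‖ < 2) : u ∈ expSubmonoid B := by
  have := congr_arg Subtype.val (expUnitary_argSelfAdjoint (u := ⟨u, hu⟩) h)
  rw [selfAdjoint.expUnitary_coe] at this
  exact Submonoid.subset_closure ⟨_, this⟩

section Order

variable [Nontrivial B] [PartialOrder B] [StarOrderedRing B]

lemma norm_one_sub_two_smul_le {p : B} (hp : 0 ≤ p) (hp1 : ‖p‖ ≤ 1) : ‖1 - (2 : ℝ) • p‖ ≤ 1 := by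
  have hsa : IsSelfAdjoint p := hp.isSelfAdjoint
  have h : 1 - (2 : ℝ) • p = cfc (fun x : ℝ => 1 - 2 * x) p := by
    rw [cfc_sub .., cfc_const_one .., cfc_const_mul .., cfc_id' ..]
  rw [h]
  refine norm_cfc_le zero_le_one fun x hx => ?_
  have h0 := spectrum_nonneg_of_nonneg hp hx
  have h1 := (spectrum.norm_le_norm_of_mem hx).trans hp1
  rw [Real.norm_eq_abs, abs_le] at h1 ⊢
  constructor <;> linarith [h1.2]

lemma exists_add_star_eq {p : B} (hp : 0 ≤ p) (hp1 : ‖p‖ ≤ 1) :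
    ∃ w ∈ expSubmonoid B, star w ∈ expSubmonoid B ∧ w + star w = (2 : ℝ) • p := by
  let a : selfAdjoint B := ⟨p, hp.isSelfAdjoint⟩
  let w := selfAdjoint.unitarySelfAddISMul a hp1
  have hw : (w : B) + star (w : B) = (2 : ℝ) • p := by
    have h := selfAdjoint.star_coe_unitarySelfAddISMul a hp1
    rw [two_smul]
    change p + I • CFC.sqrt (1 - p ^ 2) + star (w : B) = p + p
    rw [h]
    abel
  have key : ‖(w : B) - 1‖ < 2 := by
    have h1 : star ((w : B) - 1) * ((w : B) - 1) = 1 + (1 - (2 : ℝ) • p) := by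
      rw [← hw, star_sub, star_one, sub_mul, mul_sub, Unitary.coe_star_mul_self]
      noncomm_ring
    have h2 : ‖(w : B) - 1‖ * ‖(w : B) - 1‖ ≤ 2 := by
      rw [← CStarRing.norm_star_mul_self, h1]
      refine (norm_add_le _ _).trans ?_
      have := (CStarRing.norm_one (E := B)).le
      linarith [norm_one_sub_two_smul_le hp hp1]
    nlinarith [norm_nonneg ((w : B) - 1)]
  refine ⟨w, mem_expSubmonoid w.2 key, mem_expSubmonoid (star w).2 ?_, hw⟩
  rw [← norm_star]
  simpa using key

lemma exists_half_one_add_eq {z : B} (hz : ‖z‖ < 1) :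
    ∃ v ∈ expSubmonoid B, ∃ w ∈ expSubmonoid B, ∃ w' ∈ expSubmonoid B,
      1 + z = v * (w + w') := by
  set y : B := (2⁻¹ : ℝ) • (1 + z) with hy
  have hone := (CStarRing.norm_one (E := B)).le
  have hyn : ‖y‖ ≤ 1 := by
    rw [hy, norm_smul, Real.norm_of_nonneg (by norm_num)]
    linarith [norm_add_le 1 z]
  have hyu : IsUnit y := by
    have h1 : IsUnit (1 + z) := by
      have := isUnit_one_sub_of_norm_lt_one (x := -z) (by rwa [norm_neg])
      rwa [sub_neg_eq_add] at this
    rw [hy, Algebra.smul_def]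
    exact ((IsUnit.mk0 (2⁻¹ : ℝ) (by norm_num)).map (algebraMap ℝ B)).mul h1
  have ha : 0 ≤ star y * y := star_mul_self_nonneg y
  set p : B := CFC.sqrt (star y * y) with hp
  have hp0 : 0 ≤ p := CFC.sqrt_nonneg _
  have hpp : p * p = star y * y := CFC.sqrt_mul_sqrt_self _ ha
  have hps : star p = p := hp0.isSelfAdjoint.star_eq
  have hpn : ‖p‖ ≤ 1 := by
    have : ‖p‖ * ‖p‖ = ‖y‖ * ‖y‖ := by
      rw [← CStarRing.norm_star_mul_self, ← CStarRing.norm_star_mul_self, hps, hpp]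
    nlinarith [norm_nonneg p, norm_nonneg y]
  have hpu : IsUnit p := (CFC.isUnit_sqrt_iff _ ha).2 (hyu.star.mul hyu)
  obtain ⟨w, hw, hw', hww⟩ := exists_add_star_eq hp0 hpn
  obtain ⟨P, hP⟩ := hpu
  have hPs : star (↑P⁻¹ : B) = ↑P⁻¹ := by
    rw [← Units.coe_star_inv, show star P = P from Units.ext (by rw [Units.coe_star, hP, hps])]
  let v : B := y * ↑P⁻¹
  have hvp : v * p = y := by simp [v, ← hP]
  have hvs : star v * v = 1 := by
    calc star v * v = ↑P⁻¹ * (star y * y) * ↑P⁻¹ := by simp only [v, star_mul, hPs, mul_assoc]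
      _ = 1 := by simp [← hpp, ← hP]
  have hv : v ∈ unitary B :=
    (hyu.mul P⁻¹.isUnit).mem_unitary_of_star_mul_self hvs
  have hv1 : IsUnit (v + 1) := by
    have h1 : (v + 1) * p = 1 - (2⁻¹ : ℝ) • ((1 - (2 : ℝ) • p) - z) := by
      rw [add_mul, hvp, one_mul, hy]
      match_scalars <;> norm_num
    have h2 : IsUnit ((v + 1) * p) := by
      rw [h1]
      refine isUnit_one_sub_of_norm_lt_one ?_
      rw [norm_smul, Real.norm_of_nonneg (by norm_num)]
      linarith [norm_sub_le (1 - (2 : ℝ) • p) z, norm_one_sub_two_smul_le hp0 hpn]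
    have h3 : v + 1 = ((v + 1) * p) * ↑P⁻¹ := by simp [← hP, mul_assoc]
    rw [h3]
    exact h2.mul (P⁻¹).isUnit
  have hv2 : ‖v - 1‖ < 2 := by
    rw [Unitary.norm_sub_one_lt_two_iff hv, spectrum.notMem_iff]
    have : algebraMap ℂ B (-1) - v = -(v + 1) := by simp; abel
    rw [this]
    exact hv1.neg
  refine ⟨v, mem_expSubmonoid hv hv2, w, hw, star w, hw', ?_⟩
  rw [hww, mul_smul_comm, hvp, hy, smul_smul]
  norm_num

end Order

variable [Nontrivial B]

lemma half_add_mem_convexHull {x : B} (hx : ‖x‖ < 1) {c : B}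
    (hc : c ∈ convexHull ℝ (expSubmonoid B : Set B)) :
    (2⁻¹ : ℝ) • (c + x) ∈ convexHull ℝ (expSubmonoid B : Set B) := by
  let _ := CStarAlgebra.spectralOrder B
  have := CStarAlgebra.spectralOrderedRing B
  have hK := convex_convexHull ℝ (expSubmonoid B : Set B)
  refine convexHull_min (t := {c | (2⁻¹ : ℝ) • (c + x) ∈ convexHull ℝ (expSubmonoid B : Set B)})
    (fun u hu => ?_) (fun u hu v hv a b ha hb hab => ?_) hc
  · have huu : u ∈ unitary B := expSubmonoid_le_unitary hu
    have hz : ‖x * star u‖ < 1 := by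
      rwa [CStarRing.norm_mul_mem_unitary x (Unitary.star_mem huu)]
    obtain ⟨v, hv, w, hw, w', hw', h⟩ := exists_half_one_add_eq hz
    have h2 : (2⁻¹ : ℝ) • (u + x) = (2⁻¹ : ℝ) • (v * w * u) + (2⁻¹ : ℝ) • (v * w' * u) := by
      rw [← smul_add, ← add_mul, ← mul_add, ← h, add_mul, one_mul, mul_assoc,
        Unitary.star_mul_self_of_mem huu, mul_one]
    rw [Set.mem_ofPred_eq, h2]
    exact hK (subset_convexHull ℝ _ (mul_mem (mul_mem hv hw) hu))
      (subset_convexHull ℝ _ (mul_mem (mul_mem hv hw') hu)) (by norm_num) (by norm_num)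
      (by norm_num)
  · have h : (2⁻¹ : ℝ) • (a • u + b • v + x)
        = a • ((2⁻¹ : ℝ) • (u + x)) + b • ((2⁻¹ : ℝ) • (v + x)) := by
      obtain rfl : b = 1 - a := by linarith
      module
    rw [Set.mem_ofPred_eq, h]
    exact hK hu hv ha hb hab

variable {A : Type*} [NormedRing A] [NormedAlgebra ℂ A] [CompleteSpace A] [NormOneClass A]

omit [Nontrivial B] [CompleteSpace A] in
lemma norm_map_le_one_of_mem_convexHull {f : B →ₐ[ℂ] A} (hf : Continuous f)
    (hherm : ∀ h, IsSelfAdjoint h → IsHermitian (f h)) {x : B}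
    (hx : x ∈ convexHull ℝ (expSubmonoid B : Set B)) : ‖f x‖ ≤ 1 := by
  let +nondep : NormedAlgebra ℚ A := .restrictScalars ℚ ℂ A
  let +nondep : NormedAlgebra ℚ B := .restrictScalars ℚ ℂ B
  have hM : (expSubmonoid B : Set B) ⊆ {u | ‖f u‖ ≤ 1} := fun u hu => by
    induction hu using Submonoid.closure_induction with
    | mem u hu =>
      obtain ⟨h, rfl⟩ := hu
      rw [Set.mem_ofPred_eq, NormedSpace.map_exp f hf, map_smul]
      simpa using hherm h h.2 1
    | one => simp
    | mul u v _ _ hu hv =>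
      rw [Set.mem_ofPred_eq, map_mul]
      exact (norm_mul_le _ _).trans (mul_le_one₀ hu (norm_nonneg _) hv)
  have hconv : Convex ℝ {u : B | ‖f u‖ ≤ 1} := by
    have := (convex_closedBall (0 : A) 1).linear_preimage (f.toLinearMap.restrictScalars ℝ)
    simpa [Set.preimage] using this
  exact convexHull_min hM hconv hx

omit [CompleteSpace A] in
lemma norm_map_le {f : B →ₐ[ℂ] A} (hf : Continuous f)
    (hherm : ∀ h, IsSelfAdjoint h → IsHermitian (f h)) (x : B) : ‖f x‖ ≤ ‖x‖ := by
  have key {x : B} (hx : ‖x‖ < 1) : ‖f x‖ ≤ 1 := by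
    have hmem (n : ℕ) : x + (2⁻¹ : ℝ) ^ n • (1 - x) ∈ convexHull ℝ (expSubmonoid B : Set B) := by
      induction n with
      | zero => simpa using subset_convexHull ℝ _ (one_mem (expSubmonoid B))
      | succ n ih =>
        convert half_add_mem_convexHull hx ih using 1
        rw [pow_succ]
        module
    have hlim : Tendsto (fun n : ℕ => x + (2⁻¹ : ℝ) ^ n • (1 - x)) atTop (𝓝 x) := by
      have := ((tendsto_pow_atTop_nhds_zero_of_lt_one (r := (2⁻¹ : ℝ)) (by norm_num)
        (by norm_num)).smul_const (1 - x)).const_add x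
      simpa using this
    exact le_of_tendsto' ((hf.norm.tendsto x).comp hlim)
      fun n => norm_map_le_one_of_mem_convexHull hf hherm (hmem n)
  refine le_of_forall_gt_imp_ge_of_dense fun r hr => ?_
  have hr0 : 0 < r := (norm_nonneg x).trans_lt hr
  have h := key (x := ((r⁻¹ : ℝ) : ℂ) • x) (by
    rw [norm_smul, norm_real, Real.norm_of_nonneg (by positivity), inv_mul_lt_iff₀ hr0, mul_one]
    exact hr)
  rw [map_smul, norm_smul, norm_real, Real.norm_of_nonneg (by positivity), inv_mul_le_iff₀ hr0,
    mul_one] at h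
  exact h

end RussoDye

section CStarIdentity

variable {A : Type*} [NormedRing A] [NormedAlgebra ℂ A] [CompleteSpace A] [NormOneClass A]
  [StarRing A] [StarModule ℂ A] (hsa : ∀ h : A, IsSelfAdjoint h → IsHermitian h)

include hsa

lemma norm_eq_stateNorm (x : A) : ‖x‖ = stateNorm x := by
  have hle (x : A) : ‖x‖ ≤ stateNorm x := by
    have : Nontrivial (Renormed hsa) :=
      have : Nontrivial A := NormOneClass.nontrivial
      (Renormed.toOrig hsa).symm.injective.nontrivial
    exact norm_map_le (B := Renormed hsa) (f := ((Renormed.toOrig hsa).toAlgEquiv : _ →ₐ[ℂ] A))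
      (Renormed.homeo hsa).continuous (fun h hh => hsa _ (hh.map (Renormed.toOrig hsa))) x
  refine le_antisymm (hle x) ?_
  rcases (stateNorm_nonneg x).eq_or_lt with h0 | h0
  · rw [← h0]
    exact norm_nonneg x
  have h1 : stateNorm (star x) ≤ stateNorm x := by
    simpa using stateNorm_le_stateNorm_star hsa (star x)
  refine le_of_mul_le_mul_left ?_ h0
  calc stateNorm x * stateNorm x = stateNorm x ^ 2 := (sq _).symm
    _ ≤ ‖star x‖ * ‖x‖ := (stateNorm_sq_le_norm x).trans (norm_mul_le _ _)
    _ ≤ stateNorm x * ‖x‖ := by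
      gcongr
      exact (hle _).trans h1

theorem norm_star_mul_self_eq (x : A) : ‖star x * x‖ = ‖x‖ ^ 2 := by
  have h (y : A) : ‖star y‖ ≤ ‖y‖ := by
    rw [norm_eq_stateNorm hsa, norm_eq_stateNorm hsa y]
    simpa using stateNorm_le_stateNorm_star hsa (star y)
  refine le_antisymm ?_ ?_
  · rw [sq]
    exact (norm_mul_le _ _).trans (mul_le_mul_of_nonneg_right (h x) (norm_nonneg x))
  · rw [norm_eq_stateNorm hsa x]
    exact stateNorm_sq_le_norm x

end CStarIdentity

theorem norm_conj_mul_self {A : Type*} [NormedRing A] [NormedAlgebra ℂ A] [CompleteSpace A]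
    [NormOneClass A]
    (hdec : ∀ x : A, ∃ a b : A, IsHermitian a ∧ IsHermitian b ∧ x = a + I • b) (x : A) :
    ‖conj hdec x * x‖ = ‖x‖ ^ 2 := by
  let _ : StarRing A :=
    { star := conj hdec
      star_involutive := conj_conj hdec
      star_mul := conj_mul hdec
      star_add := conj_add hdec }
  have : StarModule ℂ A := ⟨conj_smul hdec⟩
  refine norm_star_mul_self_eq (fun h hh => ?_) x
  obtain ⟨a, b, ha, hb, rfl⟩ := hdec h
  have h1 : conj hdec (a + I • b) = a + I • b := hh
  rw [conj_add_I_smul hdec ha hb, sub_eq_add_neg, ← smul_neg] at h1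
  have h2 : b = 0 := by
    have h3 : (2 : ℂ) • b = 0 := by
      rw [two_smul, ← eq_neg_iff_add_eq_zero]
      exact (ha.add_I_smul_inj hb.neg ha hb h1).2.symm
    exact (smul_eq_zero.1 h3).resolve_left two_ne_zero
  rw [h2, smul_zero, add_zero]
  exact ha

end VidavPalmer

/-- Vidav–Palmer theorem: if `A = A_S + i A_S`, then
`a₁ + i a₂ ↦ a₁ - i a₂` is a well-defined involution making `A` (with its
given norm) a C*-algebra. -/
theorem stmt11 {A : Type*} [NormedRing A] [NormedAlgebra ℂ A] [CompleteSpace A]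
    (hone : ‖(1 : A)‖ = 1)
    (S : Set A)
    (hS : S = {a : A | ∀ ω : A →L[ℂ] ℂ, (‖ω‖ : ℂ) = ω 1 → (ω a).im = 0})
    (hdec : ∀ x : A, ∃ a₁ ∈ S, ∃ a₂ ∈ S, x = a₁ + Complex.I • a₂) :
    ∃ σ : A → A,
      (∀ a₁ ∈ S, ∀ a₂ ∈ S, σ (a₁ + Complex.I • a₂) = a₁ - Complex.I • a₂) ∧
      (∀ x y : A, σ (x + y) = σ x + σ y) ∧
      (∀ (c : ℂ) (x : A), σ (c • x) = (starRingEnd ℂ) c • σ x) ∧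
      (∀ x y : A, σ (x * y) = σ y * σ x) ∧
      (∀ x : A, σ (σ x) = x) ∧
      (∀ x : A, ‖σ x * x‖ = ‖x‖ ^ 2) := by
  have : NormOneClass A := ⟨hone⟩
  have hmem (a : A) : a ∈ S ↔ VidavPalmer.IsHermitian a := by
    rw [hS, VidavPalmer.isHermitian_iff_forall_norm_eq, Set.mem_ofPred_eq]
  have hdec' (x : A) : ∃ a b : A,
      VidavPalmer.IsHermitian a ∧ VidavPalmer.IsHermitian b ∧ x = a + Complex.I • b := by
    obtain ⟨a, ha, b, hb, hx⟩ := hdec x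
    exact ⟨a, b, (hmem a).1 ha, (hmem b).1 hb, hx⟩
  exact ⟨VidavPalmer.conj hdec',
    fun a ha b hb => VidavPalmer.conj_add_I_smul hdec' ((hmem a).1 ha) ((hmem b).1 hb),
    VidavPalmer.conj_add hdec', VidavPalmer.conj_smul hdec', VidavPalmer.conj_mul hdec',
    VidavPalmer.conj_conj hdec', VidavPalmer.norm_conj_mul_self hdec'⟩
end

section
/- Let A be a unital Banach *-algebra with continuous involution and identity of norm one. If for every continuous linear functional ω with ‖ω‖ = ω(1) and every self-adjoint a ∈ A the value ω(a²) is real, then A, with its given norm and involution, is a C*-algebra. -/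
open Filter Topology NormedSpace

section NumericalRange

variable {A : Type*} [NormedRing A] [NormedAlgebra ℂ A]

/-- A state is a continuous linear functional of norm one with value one at the identity. -/
def IsState (ω : A →L[ℂ] ℂ) : Prop := ‖ω‖ = 1 ∧ ω 1 = 1

lemma IsState.norm_apply_le {ω : A →L[ℂ] ℂ} (hω : IsState ω) (a : A) : ‖ω a‖ ≤ ‖a‖ := by
  simpa [hω.1] using ω.le_opNorm a

/-- For every nonzero `x` there is a state whose value at `b` is dominated by `‖b * x‖ / ‖x‖`. -/
lemma exists_isState_mul_right (hone : ‖(1 : A)‖ = 1) {x : A} (hx : x ≠ 0) :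
    ∃ ω : A →L[ℂ] ℂ, IsState ω ∧ ∀ b, ‖x‖ * (ω b).re ≤ ‖b * x‖ := by
  have hx' : ‖x‖ ≠ 0 := norm_ne_zero_iff.mpr hx
  obtain ⟨f, hf, hfx⟩ := exists_dual_vector ℂ x hx'
  let ω : A →L[ℂ] ℂ := ((‖x‖⁻¹ : ℝ) : ℂ) • f.comp ((ContinuousLinearMap.mul ℂ A).flip x)
  have hω (b : A) : ω b = ((‖x‖⁻¹ : ℝ) : ℂ) * f (b * x) := rfl
  have hω1 : ω 1 = 1 := by
    rw [hω, one_mul, hfx]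
    simp [hx']
  have hle (b : A) : ‖x‖ * ‖ω b‖ ≤ ‖b * x‖ := by
    have := f.le_opNorm (b * x)
    rw [hf, one_mul] at this
    rw [hω, norm_mul, Complex.norm_real, norm_inv, norm_norm, ← mul_assoc, mul_inv_cancel₀ hx',
      one_mul]
    exact this
  have hre (b : A) : ‖x‖ * (ω b).re ≤ ‖b * x‖ :=
    (mul_le_mul_of_nonneg_left (Complex.re_le_norm _) (norm_nonneg _)).trans (hle b)
  refine ⟨ω, ⟨le_antisymm ?_ ?_, hω1⟩, hre⟩
  · refine ω.opNorm_le_bound zero_le_one fun b => ?_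
    have h1 := (hle b).trans (norm_mul_le b x)
    rw [mul_comm ‖b‖] at h1
    rw [one_mul]
    exact le_of_mul_le_mul_left h1 (by positivity)
  · simpa [hω1, hone] using ω.le_opNorm 1

lemma one_sub_mul_norm_le (hone : ‖(1 : A)‖ = 1) {a : A} {m : ℝ}
    (ha : ∀ ω : A →L[ℂ] ℂ, IsState ω → (ω a).re ≤ m) {δ : ℝ} (hδ : 0 ≤ δ) (x : A) :
    (1 - δ * m) * ‖x‖ ≤ ‖(1 - (δ : ℂ) • a) * x‖ := by
  rcases eq_or_ne x 0 with rfl | hx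
  · simp
  obtain ⟨ω, hω, hb⟩ := exists_isState_mul_right hone hx
  refine le_trans ?_ (hb (1 - (δ : ℂ) • a))
  have h1 := mul_le_mul_of_nonneg_left (ha ω hω) hδ
  have h2 : (ω (1 - (δ : ℂ) • a)).re = 1 - δ * (ω a).re := by
    simp [hω.2]
  rw [h2, mul_comm]
  gcongr

variable [CompleteSpace A]

lemma exists_norm_exp_sub_partialSum_le (n : ℕ) :
    ∃ C > 0, ∃ r > 0, ∀ b : A, ‖b‖ < r →
      ‖exp b - (expSeries ℂ A).partialSum n b‖ ≤ C * ‖b‖ ^ n := by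
  obtain ⟨C, hC, h⟩ := ((exp_hasFPowerSeriesAt_zero (𝕂 := ℂ)
    (𝔸 := A)).isBigO_sub_partialSum_pow n).exists_pos
  obtain ⟨r, hr, h⟩ := Metric.eventually_nhds_iff.mp h.bound
  refine ⟨C, hC, r, hr, fun b hb => ?_⟩
  simpa using h (by simpa using hb)

lemma exists_norm_exp_sub_linear_le :
    ∃ C > 0, ∃ r > 0, ∀ b : A, ‖b‖ < r → ‖exp b - (1 + b)‖ ≤ C * ‖b‖ ^ 2 := by
  simpa [FormalMultilinearSeries.partialSum, Finset.sum_range_succ, expSeries_apply_eq]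
    using exists_norm_exp_sub_partialSum_le (A := A) 2

lemma exists_norm_exp_sub_quadratic_le :
    ∃ C > 0, ∃ r > 0, ∀ b : A, ‖b‖ < r →
      ‖exp b - (1 + b + (2⁻¹ : ℂ) • b ^ 2)‖ ≤ C * ‖b‖ ^ 3 := by
  simpa [FormalMultilinearSeries.partialSum, Finset.sum_range_succ, expSeries_apply_eq]
    using exists_norm_exp_sub_partialSum_le (A := A) 3

lemma exp_mul_exp_neg (a : A) : exp a * exp (-a) = 1 := by
  let := NormedAlgebra.restrictScalars ℚ ℂ A
  rw [← exp_add_of_commute (Commute.refl a).neg_right, add_neg_cancel, exp_zero]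

lemma exp_neg_mul_exp (a : A) : exp (-a) * exp a = 1 := by
  simpa using exp_mul_exp_neg (-a)

/-- The exponential is bounded by the numerical range. -/
lemma norm_exp_le (hone : ‖(1 : A)‖ = 1) {a : A} {m : ℝ}
    (ha : ∀ ω : A →L[ℂ] ℂ, IsState ω → (ω a).re ≤ m) : ‖exp a‖ ≤ Real.exp m := by
  let := NormedAlgebra.restrictScalars ℚ ℂ A
  obtain ⟨C, hC, r, hr, hexp⟩ := exists_norm_exp_sub_linear_le (A := A)
  let g : ℕ → ℝ := fun n => -m / n - C * ‖a‖ ^ 2 / n ^ 2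
  have hng : Tendsto (fun n : ℕ => (n : ℝ) * g n) atTop (𝓝 (-m)) := by
    have h0 : Tendsto (fun n : ℕ => -m - C * ‖a‖ ^ 2 / n) atTop (𝓝 (-m - 0)) :=
      tendsto_const_nhds.sub (tendsto_const_div_atTop_nhds_zero_nat _)
    rw [sub_zero] at h0
    refine h0.congr' ?_
    filter_upwards [eventually_gt_atTop 0] with n hn
    have : (n : ℝ) ≠ 0 := by positivity
    simp only [g]
    field_simp
  have hg : Tendsto g atTop (𝓝 0) := by
    have h1 : Tendsto (fun n : ℕ => -m / (n : ℝ)) atTop (𝓝 0) :=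
      tendsto_const_div_atTop_nhds_zero_nat _
    have h2 : Tendsto (fun n : ℕ => C * ‖a‖ ^ 2 / (n : ℝ) ^ 2) atTop (𝓝 0) :=
      tendsto_const_nhds.div_atTop
        ((tendsto_pow_atTop two_ne_zero).comp tendsto_natCast_atTop_atTop)
    simpa using h1.sub h2
  have hlow : ∀ᶠ n : ℕ in atTop, (1 + g n) ^ n * ‖exp a‖ ≤ 1 := by
    have hsmall : Tendsto (fun n : ℕ => ‖a‖ / (n : ℝ)) atTop (𝓝 0) :=
      tendsto_const_div_atTop_nhds_zero_nat _
    filter_upwards [eventually_gt_atTop 0, hsmall.eventually_lt_const hr,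
      hg.eventually_const_lt (show (-1 : ℝ) < 0 by norm_num)] with n hn hnr hgn
    have hn' : (0 : ℝ) < n := by positivity
    set b : A := -(((n : ℝ)⁻¹ : ℝ) : ℂ) • a with hb
    have hbn : ‖b‖ = ‖a‖ / n := by
      rw [hb, norm_smul, norm_neg, Complex.norm_real, norm_inv, Real.norm_natCast]
      field_simp
    have hstep (x : A) : (1 + g n) * ‖x‖ ≤ ‖exp b * x‖ := by
      have h1 := one_sub_mul_norm_le hone ha (inv_nonneg.mpr hn'.le) x
      have h2 := hexp b (by rwa [hbn])
      have h3 : ‖(1 + b) * x‖ ≤ ‖exp b * x‖ + C * ‖b‖ ^ 2 * ‖x‖ := by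
        calc ‖(1 + b) * x‖ = ‖exp b * x - (exp b - (1 + b)) * x‖ := by congr 1; noncomm_ring
          _ ≤ ‖exp b * x‖ + ‖(exp b - (1 + b)) * x‖ := norm_sub_le _ _
          _ ≤ _ := by
            gcongr
            exact (norm_mul_le _ _).trans (by gcongr)
      have h4 : 1 + b = 1 - (((n : ℝ)⁻¹ : ℝ) : ℂ) • a := by rw [hb, neg_smul, sub_eq_add_neg]
      rw [← h4] at h1
      have h5 : 1 + g n = 1 - (n : ℝ)⁻¹ * m - C * ‖b‖ ^ 2 := by
        rw [hbn]; simp only [g]; field_simp; ring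
      rw [h5, sub_mul]
      linarith
    have hiter (k : ℕ) (x : A) : (1 + g n) ^ k * ‖x‖ ≤ ‖exp b ^ k * x‖ := by
      induction k generalizing x with
      | zero => simp
      | succ k ih =>
        calc (1 + g n) ^ (k + 1) * ‖x‖ = (1 + g n) ^ k * ((1 + g n) * ‖x‖) := by ring
          _ ≤ (1 + g n) ^ k * ‖exp b * x‖ := by
            have : 0 ≤ 1 + g n := by linarith
            gcongr
            exact hstep x
          _ ≤ ‖exp b ^ k * (exp b * x)‖ := ih _
          _ = _ := by rw [pow_succ, mul_assoc]
    have h6 := hiter n (exp a)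
    have h7 : n • b = -a := by
      rw [hb, ← Nat.cast_smul_eq_nsmul ℂ, smul_smul]
      have : (n : ℂ) ≠ 0 := by exact_mod_cast hn'.ne'
      push_cast
      rw [mul_neg, mul_inv_cancel₀ this, neg_one_smul]
    rwa [← exp_nsmul, h7, exp_neg_mul_exp, hone] at h6
  have hlim := (Real.tendsto_one_add_pow_exp_of_tendsto hng).mul_const ‖exp a‖
  have := le_of_tendsto hlim hlow
  rw [Real.exp_neg] at this
  have hpos := Real.exp_pos m
  field_simp at this
  exact this

lemma iteratedDeriv_exp_smul (a : A) (n : ℕ) :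
    iteratedDeriv n (fun z : ℂ => exp (z • a)) = fun z => exp (z • a) * a ^ n := by
  induction n with
  | zero => simp
  | succ n ih =>
    rw [iteratedDeriv_succ, ih]
    ext z
    rw [((hasDerivAt_exp_smul_const (𝕂 := ℂ) a z).mul_const (a ^ n)).deriv, mul_assoc,
      ← pow_succ']

/-- The numerical radius controls all powers. -/
lemma norm_pow_le_of_forall_isState (hone : ‖(1 : A)‖ = 1) {a : A} {ρ : ℝ}
    (ha : ∀ ω : A →L[ℂ] ℂ, IsState ω → ‖ω a‖ ≤ ρ) (n : ℕ) {R : ℝ} (hR : 0 < R) :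
    ‖a ^ n‖ ≤ n.factorial * Real.exp (R * ρ) / R ^ n := by
  have hd : Differentiable ℂ fun z : ℂ => exp (z • a) := fun z =>
    (hasDerivAt_exp_smul_const (𝕂 := ℂ) a z).differentiableAt
  have := Complex.norm_iteratedDeriv_le_of_forall_mem_sphere_norm_le (c := 0) n hR
    hd.diffContOnCl (C := Real.exp (R * ρ)) fun z hz => norm_exp_le hone fun ω hω => ?_
  · simpa [iteratedDeriv_exp_smul] using this
  · have hz' : ‖z‖ = R := by simpa using hz
    calc (ω (z • a)).re ≤ ‖ω (z • a)‖ := Complex.re_le_norm _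
      _ = R * ‖ω a‖ := by rw [map_smul, norm_smul, hz']
      _ ≤ R * ρ := by gcongr; exact ha ω hω

lemma eq_zero_of_forall_isState (hone : ‖(1 : A)‖ = 1) {a : A}
    (ha : ∀ ω : A →L[ℂ] ℂ, IsState ω → ω a = 0) : a = 0 := by
  have h (R : ℝ) (hR : 0 < R) : ‖a‖ ≤ 1 / R := by
    simpa using norm_pow_le_of_forall_isState (ρ := 0) hone (fun ω hω => by simp [ha ω hω]) 1 hR
  have hlim : Tendsto (fun R : ℝ => 1 / R) atTop (𝓝 0) := by
    simpa using tendsto_inv_atTop_zero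
  exact norm_le_zero_iff.mp <| ge_of_tendsto hlim <|
    (eventually_gt_atTop 0).mono fun R hR => h R hR

lemma norm_pow_le_of_forall_isState_sqrt (hone : ‖(1 : A)‖ = 1) {a : A} {ρ : ℝ}
    (hρ : 0 < ρ) (ha : ∀ ω : A →L[ℂ] ℂ, IsState ω → ‖ω a‖ ≤ ρ) {n : ℕ} (hn : n ≠ 0) :
    ‖a ^ n‖ ≤ Real.exp 1 * √n * ρ ^ n := by
  have hn' : (0 : ℝ) < n := by positivity
  have h := norm_pow_le_of_forall_isState hone ha n (R := n / ρ) (by positivity)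
  obtain ⟨k, rfl⟩ := Nat.exists_eq_succ_of_ne_zero hn
  have h1 := Stirling.stirlingSeq'_antitone (Nat.zero_le k)
  simp only [Function.comp, Nat.succ_eq_add_one, zero_add, Stirling.stirlingSeq_one] at h1
  unfold Stirling.stirlingSeq at h1
  rw [Nat.succ_eq_add_one] at *
  generalize k + 1 = n at *
  have he := Real.exp_pos 1
  rw [div_le_iff₀ (by positivity), Real.sqrt_mul zero_le_two] at h1
  have h2 : Real.exp 1 / √2 * (√2 * √n * (n / Real.exp 1) ^ n) =
      Real.exp 1 * √n * (n / Real.exp 1) ^ n := by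
    field_simp
  rw [h2] at h1
  refine h.trans ?_
  have h3 : Real.exp (n / ρ * ρ) = Real.exp 1 ^ n := by
    rw [div_mul_cancel₀ _ hρ.ne', ← Real.exp_nat_mul, mul_one]
  rw [h3]
  calc n.factorial * Real.exp 1 ^ n / (n / ρ) ^ n
      ≤ Real.exp 1 * √n * (n / Real.exp 1) ^ n * Real.exp 1 ^ n / (n / ρ) ^ n := by gcongr
    _ = _ := by
      rw [div_pow, div_pow]
      field_simp

end NumericalRange

section Star

variable {A : Type*} [NormedRing A] [NormedAlgebra ℂ A] [CompleteSpace A] [StarRing A]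
  [StarModule ℂ A]

open ComplexStarModule Complex

/-- A functional that nearly attains at `1` its bound on the exponentials `exp (i k)` is nearly
nonnegative on squares of self-adjoint elements. -/
lemma exists_neg_le_re_apply_sq {K η : ℝ} (hK : 0 < K) (hη : 0 < η) :
    ∃ ε > 0, ∀ (ψ : A →L[ℂ] ℂ) (M : ℝ), ‖ψ‖ ≤ 1 → M - ε < (ψ 1).re →
      (∀ k : A, IsSelfAdjoint k → (ψ (exp (I • k))).re ≤ M) →
      ∀ k : A, IsSelfAdjoint k → ‖k‖ ≤ K → -η ≤ (ψ (k ^ 2)).re := by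
  obtain ⟨C, hC, r, hr, hexp⟩ := exists_norm_exp_sub_quadratic_le (A := A)
  obtain ⟨s, hs, hs1, hs2⟩ : ∃ s : ℝ, 0 < s ∧ s * K < r ∧ s * (C * K ^ 3) < η / 4 := by
    refine ⟨min (r / (2 * K)) (η / (8 * (C * K ^ 3))), by positivity, ?_, ?_⟩
    · calc _ ≤ r / (2 * K) * K := by gcongr; exact min_le_left _ _
        _ < r := by field_simp; linarith
    · calc _ ≤ η / (8 * (C * K ^ 3)) * (C * K ^ 3) := by gcongr; exact min_le_right _ _
        _ < _ := by field_simp; linarith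
  refine ⟨s ^ 2 * η / 4, by positivity, fun ψ M hψ hM hle k hk hkK => ?_⟩
  have key (t : ℝ) (ht : |t| = s) :
      (ψ 1).re + t * (ψ (I • k)).re - s ^ 2 / 2 * (ψ (k ^ 2)).re - C * (s * K) ^ 3 ≤ M := by
    set b : A := I • ((t : ℂ) • k) with hb
    have hbn : ‖b‖ ≤ s * K := by
      rw [hb, norm_smul, norm_smul, norm_I, norm_real, Real.norm_eq_abs, ht, one_mul]
      gcongr
    have h1 : IsSelfAdjoint ((t : ℂ) • k) := IsSelfAdjoint.smul (conj_ofReal t) hk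
    have h2 := hle _ h1
    have h3 : |(ψ (exp b - (1 + b + (2⁻¹ : ℂ) • b ^ 2))).re| ≤ C * (s * K) ^ 3 := by
      refine (abs_re_le_norm _).trans ((ψ.le_opNorm _).trans ?_)
      refine (mul_le_of_le_one_left (norm_nonneg _) hψ).trans ?_
      refine (hexp b (hbn.trans_lt hs1)).trans ?_
      gcongr
    have h4 : b ^ 2 = ((-s ^ 2 : ℝ) : ℂ) • k ^ 2 := by
      rw [hb, smul_pow, smul_pow, smul_smul, ← ht, sq_abs]
      simp
    have h5 : b = (t : ℂ) • (I • k) := smul_comm _ _ _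
    rw [h4, map_sub, map_add, map_add, h5, ← h5] at h3
    have h6 : (ψ b).re = t * (ψ (I • k)).re := by
      rw [h5, map_smul, smul_eq_mul, re_ofReal_mul]
    have h7 : (ψ ((2⁻¹ : ℂ) • ((-s ^ 2 : ℝ) : ℂ) • k ^ 2)).re = -(s ^ 2 / 2 * (ψ (k ^ 2)).re) := by
      rw [smul_smul, map_smul, smul_eq_mul, show (2⁻¹ : ℂ) * ((-s ^ 2 : ℝ) : ℂ) =
        ((-(s ^ 2 / 2) : ℝ) : ℂ) by push_cast; ring, re_ofReal_mul]
      ring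
    rw [sub_re, add_re, add_re, h6, h7] at h3
    have := (abs_le.mp h3).1
    linarith
  have h1 := key s (abs_of_pos hs)
  have h2 := key (-s) (by rw [abs_neg, abs_of_pos hs])
  have h3 : s ^ 2 * (s * (C * K ^ 3)) < s ^ 2 * (η / 4) := by gcongr
  have h4 : s ^ 2 * -η ≤ s ^ 2 * (ψ (k ^ 2)).re := by
    rw [mul_pow] at h1 h2
    linarith
  exact le_of_mul_le_mul_left h4 (by positivity)

lemma exists_re_apply_I_smul_le {K η : ℝ} (hK : 0 < K) (hη : 0 < η) :
    ∃ ε > 0, ∀ (ψ : A →L[ℂ] ℂ) (M : ℝ), ‖ψ‖ ≤ 1 → M - ε < (ψ 1).re →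
      (∀ k : A, IsSelfAdjoint k → (ψ (exp (I • k))).re ≤ M) →
      ∀ k : A, IsSelfAdjoint k → ‖k‖ ≤ K → (ψ (I • k)).re ≤ η := by
  obtain ⟨C, hC, r, hr, hexp⟩ := exists_norm_exp_sub_linear_le (A := A)
  obtain ⟨s, hs, hs1, hs2⟩ : ∃ s : ℝ, 0 < s ∧ s * K < r ∧ s * (C * K ^ 2) < η / 2 := by
    refine ⟨min (r / (2 * K)) (η / (4 * (C * K ^ 2))), by positivity, ?_, ?_⟩
    · calc _ ≤ r / (2 * K) * K := by gcongr; exact min_le_left _ _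
        _ < r := by field_simp; linarith
    · calc _ ≤ η / (4 * (C * K ^ 2)) * (C * K ^ 2) := by gcongr; exact min_le_right _ _
        _ < _ := by field_simp; linarith
  refine ⟨s * η / 2, by positivity, fun ψ M hψ hM hle k hk hkK => ?_⟩
  set b : A := I • ((s : ℂ) • k) with hb
  have hbn : ‖b‖ ≤ s * K := by
    rw [hb, norm_smul, norm_smul, norm_I, norm_real, Real.norm_eq_abs, abs_of_pos hs, one_mul]
    gcongr
  have h2 := hle _ (IsSelfAdjoint.smul (conj_ofReal s) hk)
  have h3 : |(ψ (exp b - (1 + b))).re| ≤ C * (s * K) ^ 2 := by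
    refine (abs_re_le_norm _).trans ((ψ.le_opNorm _).trans ?_)
    refine (mul_le_of_le_one_left (norm_nonneg _) hψ).trans ?_
    refine (hexp b (hbn.trans_lt hs1)).trans ?_
    gcongr
  have h5 : (ψ b).re = s * (ψ (I • k)).re := by
    rw [hb, smul_comm, map_smul, smul_eq_mul, re_ofReal_mul]
  rw [map_sub, map_add, sub_re, add_re, h5] at h3
  have h4 := (abs_le.mp h3).1
  have h6 : s * (s * (C * K ^ 2)) < s * (η / 2) := by gcongr
  have h7 : s * (ψ (I • k)).re ≤ s * η := by
    rw [mul_pow] at h4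
    linarith
  exact le_of_mul_le_mul_left h7 hs

variable (hone : ‖(1 : A)‖ = 1)
  (hsa : ∀ ω : A →L[ℂ] ℂ, IsState ω → ∀ a : A, IsSelfAdjoint a → (ω a).im = 0)

include hone hsa

omit [StarModule ℂ A] in
lemma norm_exp_I_smul_le {k : A} (hk : IsSelfAdjoint k) : ‖exp (I • k)‖ ≤ 1 := by
  simpa using norm_exp_le (m := 0) hone (a := I • k) fun ω hω => by simp [hsa ω hω k hk]

lemma IsState.re_apply_sq_nonneg {ω : A →L[ℂ] ℂ} (hω : IsState ω) {k : A}
    (hk : IsSelfAdjoint k) : 0 ≤ (ω (k ^ 2)).re := by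
  refine le_of_forall_pos_le_add fun η hη => ?_
  obtain ⟨ε, hε, h⟩ := exists_neg_le_re_apply_sq (A := A) (K := ‖k‖ + 1) (by positivity) hη
  have := h ω 1 hω.1.le (by simp [hω.2, hε]) (fun k hk => (re_le_norm _).trans
    ((hω.norm_apply_le _).trans (norm_exp_I_smul_le hone hsa hk))) k hk (by simp)
  linarith

lemma IsState.norm_apply_realPart_sq_le {ω : A →L[ℂ] ℂ} (hω : IsState ω) {y : A}
    (h1 : ‖star y * y‖ ≤ 1) (h2 : ‖y * star y‖ ≤ 1) : ‖ω ((ℜ y : A) ^ 2)‖ ≤ 1 := by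
  have hx := hω.re_apply_sq_nonneg hone hsa (ℜ y).2
  have hz := hω.re_apply_sq_nonneg hone hsa (ℑ y).2
  have him : (ω ((ℜ y : A) ^ 2)).im = 0 := hsa ω hω _ ((ℜ y).2.pow 2)
  have hsum := congrArg (fun a => (ω a).re) (star_mul_self_add_self_mul_star y)
  simp only [map_add, map_nsmul, add_re] at hsum
  have h3 := (re_le_norm _).trans ((hω.norm_apply_le _).trans h1)
  have h4 := (re_le_norm _).trans ((hω.norm_apply_le _).trans h2)
  rw [← re_add_im (ω ((ℜ y : A) ^ 2)), him, ofReal_zero, zero_mul, add_zero, norm_real,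
    Real.norm_of_nonneg hx]
  simp only [← sq, nsmul_eq_mul, Nat.cast_ofNat, mul_re, re_ofNat, im_ofNat, zero_mul, sub_zero,
    add_re] at hsum
  linarith

lemma norm_realPart_pow_le {y : A} (h1 : ‖star y * y‖ ≤ 1) (h2 : ‖y * star y‖ ≤ 1) (k : ℕ) :
    ‖(ℜ y : A) ^ 2 ^ (k + 1)‖ ≤ Real.exp 1 * √2 ^ k := by
  have := norm_pow_le_of_forall_isState_sqrt hone zero_lt_one
    (fun ω hω => hω.norm_apply_realPart_sq_le hone hsa h1 h2) (n := 2 ^ k) (by positivity)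
  rw [← pow_mul, ← pow_succ', one_pow, mul_one] at this
  refine this.trans (le_of_eq ?_)
  congr 1
  rw [Nat.cast_pow, Nat.cast_ofNat, Real.sqrt_eq_iff_mul_self_eq (by positivity) (by positivity),
    ← mul_pow, Real.mul_self_sqrt zero_le_two]

omit [CompleteSpace A] [StarRing A] [StarModule ℂ A] hone hsa in
lemma neg_le_re_apply_one_sub {ψ : A →L[ℂ] ℂ} {x : A} {η : ℝ} (k : ℕ)
    (h : ∀ j < k, -η ≤ (ψ ((1 - x ^ 2 ^ j) ^ 2)).re) :
    -η * (1 - 2⁻¹ ^ k) + 2⁻¹ ^ k * (ψ (1 - x ^ 2 ^ k)).re ≤ (ψ (1 - x)).re := by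
  induction k with
  | zero => simp
  | succ k ih =>
    refine le_trans ?_ (ih fun j hj => h j (by omega))
    have h1 := h k (by omega)
    have h2 : (1 - x ^ 2 ^ k) + (1 - x ^ 2 ^ k) = (1 - x ^ 2 ^ k) ^ 2 + (1 - x ^ 2 ^ (k + 1)) := by
      rw [pow_succ 2 k, pow_mul]
      noncomm_ring
    have h3 := congrArg (fun a => (ψ a).re) h2
    simp only [map_add, add_re] at h3
    have h4 : (0 : ℝ) < 2⁻¹ ^ k := by positivity
    rw [pow_succ]
    nlinarith

omit [CompleteSpace A] hone hsa in
lemma star_exp_I_smul [ContinuousStar A] {k : A} (hk : IsSelfAdjoint k) :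
    star (exp (I • k)) = exp (-(I • k)) := by
  rw [star_exp, star_smul, hk.star_eq, RCLike.star_def, conj_I, neg_smul]

/-- A Russo–Dye type estimate. A functional norming `y` is compared, near its supremum over the
contractive unitaries `u`, with `1 - ℜ (star u * y)` written as a sum of squares. -/
lemma norm_le_one_of_norm_star_mul_self_le [ContinuousStar A] {y : A}
    (h1 : ‖star y * y‖ ≤ 1) (h2 : ‖y * star y‖ ≤ 1) : ‖y‖ ≤ 1 := by
  obtain ⟨f, hf, hfy⟩ := exists_dual_vector'' ℂ y
  let G : Set A := {u | star u * u = 1 ∧ u * star u = 1 ∧ ‖u‖ ≤ 1 ∧ ‖star u‖ ≤ 1}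
  let S : Set ℝ := (fun u => (f u).re) '' G
  have hf1 (u : A) : ‖f u‖ ≤ ‖u‖ :=
    (f.le_opNorm u).trans (mul_le_of_le_one_left (norm_nonneg _) hf)
  have hS1 : ∀ t ∈ S, t ≤ 1 := by
    rintro _ ⟨u, hu, rfl⟩
    exact (re_le_norm _).trans ((hf1 u).trans hu.2.2.1)
  have hS : BddAbove S := ⟨1, hS1⟩
  have hSne : S.Nonempty := ⟨_, 1, by simp [G, hone], rfl⟩
  have hGexp {u : A} (hu : u ∈ G) {k : A} (hk : IsSelfAdjoint k) : u * exp (I • k) ∈ G := by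
    obtain ⟨hu1, hu2, hu3, hu4⟩ := hu
    have hs := star_exp_I_smul hk
    have he := norm_exp_I_smul_le hone hsa hk
    have he' : ‖exp (-(I • k))‖ ≤ 1 := by
      simpa using norm_exp_I_smul_le hone hsa hk.neg
    refine ⟨?_, ?_, ?_, ?_⟩
    · rw [star_mul, hs, mul_assoc, ← mul_assoc (star u), hu1, one_mul, exp_neg_mul_exp]
    · rw [star_mul, hs, mul_assoc, ← mul_assoc (exp (I • k)), exp_mul_exp_neg, one_mul, hu2]
    · exact (norm_mul_le _ _).trans (mul_le_one₀ hu3 (norm_nonneg _) he)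
    · rw [star_mul, hs]
      exact (norm_mul_le _ _).trans (mul_le_one₀ he' (norm_nonneg _) hu4)
  set M := sSup S
  have hM1 : M ≤ 1 := csSup_le hSne hS1
  suffices h : ‖y‖ ≤ M from h.trans hM1
  refine le_of_forall_pos_le_add fun η hη => ?_
  obtain ⟨n, hn⟩ : ∃ n : ℕ,
      (2⁻¹ : ℝ) ^ (n + 1) * (1 + Real.exp 1 * √2 ^ n) < η / 3 := by
    have h0 : Tendsto (fun n : ℕ => (2⁻¹ : ℝ) ^ (n + 1) * (1 + Real.exp 1 * √2 ^ n))
        atTop (𝓝 0) := by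
      have ha : Tendsto (fun n : ℕ => (2⁻¹ : ℝ) ^ n) atTop (𝓝 0) :=
        tendsto_pow_atTop_nhds_zero_of_lt_one (by norm_num) (by norm_num)
      have hb : Tendsto (fun n : ℕ => (2⁻¹ * √2) ^ n) atTop (𝓝 0) := by
        refine tendsto_pow_atTop_nhds_zero_of_lt_one (by positivity) ?_
        nlinarith [Real.sq_sqrt zero_le_two, Real.sqrt_nonneg 2]
      have hc := (ha.add (hb.const_mul (Real.exp 1))).const_mul 2⁻¹
      simp only [mul_zero, add_zero] at hc
      refine hc.congr fun n => ?_
      rw [mul_pow]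
      ring
    exact (h0.eventually_lt_const (by positivity)).exists
  let K : ℝ := 1 + Real.exp 1 * √2 ^ n + (‖y‖ + ‖star y‖)
  have hK : 0 < K := by positivity
  obtain ⟨ε₁, hε₁, hq⟩ := exists_neg_le_re_apply_sq (A := A) hK (show 0 < η / 3 by positivity)
  obtain ⟨ε₂, hε₂, hl⟩ := exists_re_apply_I_smul_le (A := A) hK (show 0 < η / 3 by positivity)
  obtain ⟨_, ⟨u, hu, rfl⟩, hfu⟩ := exists_lt_of_lt_csSup hSne
    (show M - min ε₁ ε₂ < sSup S from sub_lt_self _ (lt_min hε₁ hε₂))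
  let ψ : A →L[ℂ] ℂ := f.comp (ContinuousLinearMap.mul ℂ A u)
  have hψa (a : A) : ψ a = f (u * a) := rfl
  have hψ1 (a : A) : ‖ψ a‖ ≤ ‖a‖ := (hf1 _).trans <| (norm_mul_le _ _).trans <|
    mul_le_of_le_one_left (norm_nonneg _) hu.2.2.1
  have hψ : ‖ψ‖ ≤ 1 := ψ.opNorm_le_bound zero_le_one (by simpa using hψ1)
  have hψexp (k : A) (hk : IsSelfAdjoint k) : (ψ (exp (I • k))).re ≤ M :=
    le_csSup hS ⟨_, hGexp hu hk, rfl⟩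
  have hψone : (ψ 1).re ≤ M := by simpa using hψexp 0 (.zero A)
  have hψu : M - min ε₁ ε₂ < (ψ 1).re := by simpa [hψa] using hfu
  replace hq := hq ψ M hψ ((sub_le_sub_left (min_le_left _ _) _).trans_lt hψu) hψexp
  replace hl := hl ψ M hψ ((sub_le_sub_left (min_le_right _ _) _).trans_lt hψu) hψexp
  obtain ⟨hu1, hu2, hu3, hu4⟩ := hu
  set v : A := star u * y with hv
  have hv1 : ‖star v * v‖ ≤ 1 := by
    rwa [hv, star_mul, star_star, mul_assoc, ← mul_assoc u, hu2, one_mul]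
  have hv2 : ‖v * star v‖ ≤ 1 := by
    rw [hv, star_mul, star_star, mul_assoc, ← mul_assoc y]
    exact (norm_mul_le _ _).trans (mul_le_one₀ hu4 (norm_nonneg _)
      ((norm_mul_le _ _).trans (mul_le_one₀ h2 (norm_nonneg _) hu3)))
  have hvn : ‖v‖ ≤ ‖y‖ :=
    (norm_mul_le _ _).trans (mul_le_of_le_one_left (norm_nonneg _) hu4)
  have hvn' : ‖star v‖ ≤ ‖star y‖ := by
    rw [hv, star_mul, star_star]
    exact (norm_mul_le _ _).trans (mul_le_of_le_one_right (norm_nonneg _) hu3)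
  set x : A := (ℜ v : A) with hx
  set z : A := (ℑ v : A) with hz
  have hxn : ‖x‖ ≤ ‖y‖ + ‖star y‖ := by
    rw [hx, realPart_apply_coe, norm_smul]
    have := norm_add_le v (star v)
    norm_num
    linarith [norm_nonneg (v + star v)]
  have hzn : ‖z‖ ≤ ‖y‖ + ‖star y‖ := by
    rw [hz, imaginaryPart_apply_coe, norm_smul, norm_smul]
    have := norm_sub_le v (star v)
    norm_num
    linarith [norm_nonneg (v - star v)]
  have hpow (j : ℕ) (hj : j ≤ n) : ‖x ^ 2 ^ (j + 1)‖ ≤ Real.exp 1 * √2 ^ n := by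
    refine (norm_realPart_pow_le hone hsa hv1 hv2 j).trans ?_
    gcongr
    exact Real.one_le_sqrt.mpr one_le_two
  have hsq : ∀ j < n + 1, -(η / 3) ≤ (ψ ((1 - x ^ 2 ^ j) ^ 2)).re := by
    intro j hj
    refine hq _ ((IsSelfAdjoint.one A).sub ((ℜ v).2.pow _)) ?_
    refine (norm_sub_le _ _).trans ?_
    rw [hone]
    cases j with
    | zero =>
      have : 0 ≤ Real.exp 1 * √2 ^ n := by positivity
      simp only [pow_zero, pow_one, K]
      linarith
    | succ j =>
      have := hpow j (by omega)
      simp only [K]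
      linarith [norm_nonneg y, norm_nonneg (star y)]
  have hI : (ψ (I • z)).re ≤ η / 3 := by
    refine hl z (ℑ v).2 (hzn.trans ?_)
    have : 0 ≤ Real.exp 1 * √2 ^ n := by positivity
    simp only [K]
    linarith
  have hR := neg_le_re_apply_one_sub (n + 1) hsq
  have hrem : |(ψ (1 - x ^ 2 ^ (n + 1))).re| ≤ 1 + Real.exp 1 * √2 ^ n := by
    refine (abs_re_le_norm _).trans ((hψ1 _).trans ((norm_sub_le _ _).trans ?_))
    rw [hone]
    gcongr
    exact hpow n le_rfl
  have hrem' := mul_le_mul_of_nonneg_left (abs_le.mp hrem).1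
    (show (0 : ℝ) ≤ 2⁻¹ ^ (n + 1) by positivity)
  have h2n : 0 ≤ η / 3 * (2⁻¹ : ℝ) ^ (n + 1) := by positivity
  have hy : u * (x + I • z) = y := by
    rw [hx, hz, realPart_add_I_smul_imaginaryPart, hv, ← mul_assoc, hu2, one_mul]
  have hfin : ‖y‖ = (ψ x).re + (ψ (I • z)).re := by
    rw [← add_re, ← map_add, hψa, hy, hfy]
    simp
  have hsub : (ψ (1 - x)).re = (ψ 1).re - (ψ x).re := by rw [map_sub, sub_re]
  rw [hsub] at hR
  rw [hfin]
  linarith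

lemma norm_sq_le_max [ContinuousStar A] (a : A) : ‖a‖ ^ 2 ≤ max ‖star a * a‖ ‖a * star a‖ := by
  set m := max ‖star a * a‖ ‖a * star a‖
  have hm : 0 ≤ m := (norm_nonneg _).trans (le_max_left _ _)
  suffices h : ‖a‖ ≤ √m from (Real.le_sqrt (norm_nonneg _) hm).mp h
  refine le_of_forall_pos_le_add fun ε hε => ?_
  set t := √m + ε
  have ht : 0 < t := by positivity
  have hmt : m ≤ t ^ 2 := (Real.sqrt_le_left ht.le).mp (le_add_of_nonneg_right hε.le)
  have hs : star (((t⁻¹ : ℝ) : ℂ) • a) = ((t⁻¹ : ℝ) : ℂ) • star a := by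
    rw [star_smul, RCLike.star_def, conj_ofReal]
  have hn (b : A) (hb : ‖b‖ ≤ m) :
      ‖((t⁻¹ : ℝ) : ℂ) • ((t⁻¹ : ℝ) : ℂ) • b‖ ≤ 1 := by
    rw [norm_smul, norm_smul, norm_real, Real.norm_of_nonneg (inv_nonneg.mpr ht.le)]
    field_simp
    exact hb.trans hmt
  have := norm_le_one_of_norm_star_mul_self_le hone hsa (y := ((t⁻¹ : ℝ) : ℂ) • a)
    (by rw [hs, smul_mul_smul_comm, ← smul_smul]; exact hn _ (le_max_left _ _))
    (by rw [hs, smul_mul_smul_comm, ← smul_smul]; exact hn _ (le_max_right _ _))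
  rw [norm_smul, norm_real, Real.norm_of_nonneg (inv_nonneg.mpr ht.le)] at this
  field_simp at this
  exact this

/-- The C*-identity for a Banach star algebra whose self-adjoint elements are Hermitian. -/
lemma norm_star_mul_self_eq [ContinuousStar A] (a : A) : ‖star a * a‖ = ‖a‖ ^ 2 := by
  have hle (b : A) : ‖b‖ ≤ ‖star b‖ := by
    have h1 := norm_sq_le_max hone hsa b
    have h2 : max ‖star b * b‖ ‖b * star b‖ ≤ ‖star b‖ * ‖b‖ :=
      max_le (norm_mul_le _ _) (by rw [mul_comm]; exact norm_mul_le _ _)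
    rcases (norm_nonneg b).eq_or_lt with h0 | h0
    · rw [← h0]; exact norm_nonneg _
    · refine le_of_mul_le_mul_right ?_ h0
      rw [← sq]
      exact h1.trans h2
  have hstar : ‖star a‖ = ‖a‖ := le_antisymm (by simpa using hle (star a)) (hle a)
  have h1 : ‖star a * a‖ ≤ ‖a‖ ^ 2 := by
    rw [sq]
    exact (norm_mul_le _ _).trans (by rw [hstar])
  refine le_antisymm h1 ?_
  rcases le_max_iff.mp (norm_sq_le_max hone hsa a) with h | h
  · exact h
  rcases (norm_nonneg a).eq_or_lt with h0 | h0
  · rw [← h0]; simp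
  have h2 : (‖a‖ ^ 2) ^ 2 ≤ ‖(a * star a) ^ 2‖ := by
    have h3 := norm_sq_le_max hone hsa (a * star a)
    rw [(IsSelfAdjoint.mul_star_self a).star_eq, max_self, ← sq] at h3
    exact le_trans (by gcongr) h3
  have h4 : ‖(a * star a) ^ 2‖ ≤ ‖a‖ ^ 2 * ‖star a * a‖ := by
    calc ‖(a * star a) ^ 2‖ = ‖a * (star a * a) * star a‖ := by congr 1; noncomm_ring
      _ ≤ ‖a‖ * ‖star a * a‖ * ‖star a‖ := norm_mul₃_le
      _ = _ := by rw [hstar]; ring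
  have h5 := h2.trans h4
  rw [sq (‖a‖ ^ 2)] at h5
  exact le_of_mul_le_mul_left h5 (by positivity)

omit [StarModule ℂ A] in
/-- The involution is automatically conjugate linear. -/
lemma starModule_of_isSelfAdjoint_im_eq_zero [ContinuousStar A] : StarModule ℂ A := by
  set i : A := algebraMap ℂ A I with hi
  have hi2 : i * i = -1 := by rw [hi, ← map_mul, I_mul_I, map_neg, map_one]
  have hcomm (b : A) : i * b = b * i := Algebra.commutes I b
  have hj2 : star i * star i = -1 := by rw [← star_mul, hi2, star_neg, star_one]
  set q : A := 1 - i * star i with hq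
  have hqs : IsSelfAdjoint q := by
    rw [isSelfAdjoint_iff, hq, star_sub, star_one, star_mul, star_star]
  have hIq : I • q = i + star i := by
    rw [Algebra.smul_def, ← hi, hq, mul_sub, mul_one, ← mul_assoc, hi2]
    noncomm_ring
  have hIqs : IsSelfAdjoint (I • q) := by
    rw [hIq, isSelfAdjoint_iff, star_add, star_star, add_comm]
  have hq0 : q = 0 := eq_zero_of_forall_isState hone fun ω hω => by
    have h1 := hsa ω hω q hqs
    have h2 := hsa ω hω _ hIqs
    rw [map_smul, smul_eq_mul, I_mul_im] at h2
    exact Complex.ext h2 h1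
  have hstar_i : star i = -i := by
    rw [hq0, smul_zero] at hIq
    exact (neg_eq_of_add_eq_zero_right hIq.symm).symm
  have hreal (t : ℝ) (b : A) : star (t • b) = t • star b :=
    map_real_smul (starAddEquiv : A ≃+ A) continuous_star t b
  refine ⟨fun c b => ?_⟩
  have hc (c : ℂ) (b : A) : c • b = c.re • b + c.im • (i * b) := by
    rw [hi, ← Algebra.smul_def]
    conv_lhs => rw [← re_add_im c]
    rw [add_smul, mul_smul, coe_smul, coe_smul]
  rw [hc, hc, star_add, hreal, hreal, star_mul, hstar_i, mul_neg, ← hcomm]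
  simp

end Star

/-- If for every continuous linear functional `ω` with `‖ω‖ = ω(1)` and every
self-adjoint `a` the value `ω(a²)` is real, then the given norm and involution
satisfy the C*-identity. -/
theorem stmt14 {A : Type*} [NormedRing A] [NormedAlgebra ℂ A] [CompleteSpace A]
    [StarRing A] (hcont : Continuous (star : A → A)) (hone : ‖(1 : A)‖ = 1)
    (h : ∀ ω : A →L[ℂ] ℂ, (‖ω‖ : ℂ) = ω 1 →
      ∀ a : A, star a = a → (ω (a ^ 2)).im = 0) :
    ∀ a : A, ‖star a * a‖ = ‖a‖ ^ 2 := by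
  have : ContinuousStar A := ⟨hcont⟩
  have hsa (ω : A →L[ℂ] ℂ) (hω : IsState ω) (a : A) (ha : IsSelfAdjoint a) : (ω a).im = 0 := by
    have hω1 : (‖ω‖ : ℂ) = ω 1 := by rw [hω.1, hω.2, Complex.ofReal_one]
    have h1 := h ω hω1 a ha.star_eq
    have h2 := h ω hω1 (a + 1) (ha.add (.one A)).star_eq
    have h3 : (a + 1) ^ 2 = a ^ 2 + a + a + 1 := by noncomm_ring
    rw [h3, map_add, map_add, map_add, hω.2] at h2
    simp only [Complex.add_im, Complex.one_im, h1] at h2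
    linarith
  have := starModule_of_isSelfAdjoint_im_eq_zero hone hsa
  exact norm_star_mul_self_eq hone hsa
end
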